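/- Let A, B be invertible N×N complex matrices and let λ, μ be partitions with at most N parts. Then ∫_{SU(N)} s_λ(UA) s_μ(U† B) dμ(U) = δ_{μ,λ} · s_λ(AB)/s_λ(I_N) + Σ_{q≥1} δ_{μ, λ+q^N} · (s_μ(AB)/s_μ(I_N)) · (det A)^{−q} + Σ_{q≥1} δ_{λ, μ+q^N} · (s_λ(AB)/s_λ(I_N)) · (det B)^{−q}, where at most one of the terms on the right-hand side is nonzero. -/

import Mathlib

open scoped BigOperators Classical
open MeasureTheory Matrix

noncomputable section

/-- Complete homogeneous symmetric functions of the eigenvalues of `X`, defined through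
Newton's identities from the power sums `p_m = Tr(X^m)`. -/
def hMat {N : ℕ} (X : Matrix (Fin N) (Fin N) ℂ) : ℕ → ℂ
  | 0 => 1
  | (k+1) => ((k : ℂ) + 1)⁻¹ *
      ∑ m ∈ Finset.range (k+1), (X ^ (m+1)).trace * hMat X (k - m)
  termination_by k => k
  decreasing_by exact Nat.lt_succ_of_le (Nat.sub_le _ _)

def hMatZ {N : ℕ} (X : Matrix (Fin N) (Fin N) ℂ) (k : ℤ) : ℂ :=
  if k < 0 then 0 else hMat X k.toNat

/-- The Schur polynomial `s_λ(X)` of an `N×N` complex matrix `X`, evaluated at the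
eigenvalues of `X`, via the Jacobi-Trudi formula `s_λ = det(h_{λ_i - i + j})`.
Here `l : Fin N → ℕ` lists the (at most `N`) parts of the partition `λ`. -/
def schur {N : ℕ} (l : Fin N → ℕ) (X : Matrix (Fin N) (Fin N) ℂ) : ℂ :=
  (Matrix.of fun i j : Fin N => hMatZ X ((l i : ℤ) - (i : ℤ) + (j : ℤ))).det

/-- Partitions with at most `N` parts (weakly decreasing functions `Fin N → ℕ`). -/
def PartitionN (N : ℕ) := {l : Fin N → ℕ // Antitone l}

/-- The unitary group `U(N)`. -/
abbrev UN (N : ℕ) := Matrix.unitaryGroup (Fin N) ℂ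

instance (N : ℕ) : MeasurableSpace (UN N) := borel _

/-- The special unitary group `SU(N)`, as a subgroup of `U(N)`. -/
def SUN (N : ℕ) : Subgroup (UN N) where
  carrier := {U | (U : Matrix (Fin N) (Fin N) ℂ).det = 1}
  one_mem' := by simp
  mul_mem' := by
    intro a b ha hb
    simp only [Set.mem_setOf_eq, Submonoid.coe_mul, Matrix.det_mul] at *
    rw [ha, hb, mul_one]
  inv_mem' := by
    intro a ha
    simp only [Set.mem_setOf_eq] at *
    have h1 : ((a⁻¹ : UN N) : Matrix (Fin N) (Fin N) ℂ)
        = star (a : Matrix (Fin N) (Fin N) ℂ) := rfl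
    have h2 : (star (a : Matrix (Fin N) (Fin N) ℂ)).det
        = star ((a : Matrix (Fin N) (Fin N) ℂ)).det := by
      simp [Matrix.star_eq_conjTranspose, Matrix.det_conjTranspose]
    rw [h1, h2, ha, star_one]

instance (N : ℕ) : MeasurableSpace (SUN N) := borel _

section CompactGroup

open scoped Matrix.Norms.Elementwise

set_option linter.unusedSectionVars false

variable {G : Type*} [Group G] [TopologicalSpace G] [IsTopologicalGroup G] [CompactSpace G]
  [MeasurableSpace G] [BorelSpace G]

theorem integrable_of_continuous_of_compactSpace {E : Type*} [NormedAddCommGroup E]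
    {μ : Measure G} [IsFiniteMeasureOnCompacts μ]
    {f : G → E} (hf : Continuous f) : Integrable f μ :=
  hf.integrable_of_hasCompactSupport (HasCompactSupport.of_compactSpace f)

theorem integral_swap_of_compactSpace {E : Type*} [NormedAddCommGroup E] [NormedSpace ℝ E]
    {μ : Measure G} [IsFiniteMeasureOnCompacts μ] {f : G → G → E}
    (hf : Continuous (Function.uncurry f)) :
    ∫ x, ∫ y, f x y ∂μ ∂μ = ∫ y, ∫ x, f x y ∂μ ∂μ :=
  integral_integral_swap_of_hasCompactSupport hf (HasCompactSupport.of_compactSpace _)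

theorem map_integral_matrix {ι : Type*} [Fintype ι] {μ : Measure G}
    [IsFiniteMeasureOnCompacts μ] {E : Type*} [NormedAddCommGroup E] [NormedSpace ℂ E]
    [FiniteDimensional ℂ E]
    (L : Matrix ι ι ℂ →ₗ[ℂ] E) {f : G → Matrix ι ι ℂ} (hf : Continuous f) :
    L (∫ g, f g ∂μ) = ∫ g, L (f g) ∂μ := by
  have : CompleteSpace E := FiniteDimensional.complete ℂ E
  exact ((LinearMap.toContinuousLinearMap L).integral_comp_comm
    (integrable_of_continuous_of_compactSpace hf)).symm

/-- The average of `ρ(g) T ρ(g)⁻¹` over a compact group. -/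
def conjAverage {ι : Type*} [Fintype ι] (μ : Measure G) [DecidableEq ι] (ρ : G →* Matrix ι ι ℂ)
    (T : Matrix ι ι ℂ) : Matrix ι ι ℂ := ∫ g, ρ g * T * ρ g⁻¹ ∂μ

section Average

variable {ι : Type*} [Fintype ι] [DecidableEq ι] {μ : Measure G} [IsProbabilityMeasure μ]
  {ρ : G →* Matrix ι ι ℂ}

theorem map_conjAverage {E : Type*} [NormedAddCommGroup E] [NormedSpace ℂ E]
    [FiniteDimensional ℂ E] (hρ : Continuous ρ) (L : Matrix ι ι ℂ →ₗ[ℂ] E) (T : Matrix ι ι ℂ) :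
    L (conjAverage μ ρ T) = ∫ g, L (ρ g * T * ρ g⁻¹) ∂μ :=
  map_integral_matrix L (by fun_prop)

theorem trace_mul_conjAverage (hρ : Continuous ρ) (C T : Matrix ι ι ℂ) :
    (C * conjAverage μ ρ T).trace = ∫ g, (C * (ρ g * T * ρ g⁻¹)).trace ∂μ :=
  map_conjAverage hρ ((Matrix.traceLinearMap ι ℂ ℂ) ∘ₗ (LinearMap.mulLeft ℂ C)) T

theorem conjAverage_commute [μ.IsMulLeftInvariant] (hρ : Continuous ρ) (T : Matrix ι ι ℂ) (h : G) :
    ρ h * conjAverage μ ρ T = conjAverage μ ρ T * ρ h := by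
  have h1 : ρ h * conjAverage μ ρ T * ρ h⁻¹ = conjAverage μ ρ T := by
    have := map_conjAverage (μ := μ) hρ
      ((LinearMap.mulRight ℂ (ρ h⁻¹)) ∘ₗ (LinearMap.mulLeft ℂ (ρ h))) T
    simp only [LinearMap.comp_apply, LinearMap.mulLeft_apply, LinearMap.mulRight_apply] at this
    rw [this]
    conv_rhs => rw [conjAverage, ← integral_mul_left_eq_self _ h]
    congr 1
    ext1 g
    simp only [map_mul, _root_.mul_inv_rev, mul_assoc]
  calc ρ h * conjAverage μ ρ T = ρ h * conjAverage μ ρ T * (ρ h⁻¹ * ρ h) := by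
        rw [← map_mul]; simp
    _ = conjAverage μ ρ T * ρ h := by rw [← mul_assoc, h1]

theorem conjAverage_eq_self_of_commute {T : Matrix ι ι ℂ} (hT : ∀ g, ρ g * T = T * ρ g) :
    conjAverage μ ρ T = T := by
  have : ∀ g, ρ g * T * ρ g⁻¹ = T := fun g => by
    rw [hT, mul_assoc, ← map_mul]; simp
  simp [conjAverage, this]

/-- The linear map `T ↦ P * avg(T) * Q`. -/
def averageProj (hρ : Continuous ρ) (μ : Measure G) [IsProbabilityMeasure μ] (P Q : Matrix ι ι ℂ) :
    Matrix ι ι ℂ →ₗ[ℂ] Matrix ι ι ℂ where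
  toFun T := P * conjAverage μ ρ T * Q
  map_add' S T := by
    rw [← add_mul, ← mul_add]
    congr 2
    rw [conjAverage, conjAverage, conjAverage, ← integral_add]
    · simp [mul_add, add_mul]
    · exact integrable_of_continuous_of_compactSpace (by fun_prop)
    · exact integrable_of_continuous_of_compactSpace (by fun_prop)
  map_smul' c T := by
    simp [conjAverage, integral_smul]

/-- The matrices commuting with `ρ` and fixed by `T ↦ P * T * Q`. -/
def commutantBlock (ρ : G →* Matrix ι ι ℂ) (P Q : Matrix ι ι ℂ) : Submodule ℂ (Matrix ι ι ℂ) where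
  carrier := {T | (∀ g, ρ g * T = T * ρ g) ∧ P * T * Q = T}
  add_mem' := by
    rintro S T ⟨h1, h2⟩ ⟨h3, h4⟩
    exact ⟨fun g => by rw [mul_add, add_mul, h1, h3], by rw [mul_add, add_mul, h2, h4]⟩
  zero_mem' := by simp
  smul_mem' := by
    rintro c T ⟨h1, h2⟩
    exact ⟨fun g => by simp [h1 g], by simp [h2]⟩

theorem isProj_averageProj [μ.IsMulLeftInvariant] (hρ : Continuous ρ) {P Q : Matrix ι ι ℂ}
    (hP : P * P = P) (hQ : Q * Q = Q) (hPρ : ∀ g, ρ g * P = P * ρ g)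
    (hQρ : ∀ g, ρ g * Q = Q * ρ g) :
    LinearMap.IsProj (commutantBlock ρ P Q) (averageProj hρ μ P Q) where
  map_mem T := by
    refine ⟨fun g => ?_, ?_⟩
    · change ρ g * (P * conjAverage μ ρ T * Q) = (P * conjAverage μ ρ T * Q) * ρ g
      rw [← mul_assoc, ← mul_assoc, hPρ, mul_assoc P, conjAverage_commute hρ]
      simp only [mul_assoc, hQρ]
    · change P * (P * conjAverage μ ρ T * Q) * Q = (P * conjAverage μ ρ T * Q)
      calc _ = (P * P) * conjAverage μ ρ T * (Q * Q) := by simp only [mul_assoc]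
        _ = _ := by rw [hP, hQ]
  map_id T hT := by
    change P * conjAverage μ ρ T * Q = T
    rw [conjAverage_eq_self_of_commute hT.1, hT.2]

theorem linearMap_trace_matrix (E : Matrix ι ι ℂ →ₗ[ℂ] Matrix ι ι ℂ) :
    LinearMap.trace ℂ _ E = ∑ i, ∑ j, E (Matrix.single i j 1) i j := by
  rw [LinearMap.trace_eq_matrix_trace ℂ (Matrix.stdBasis ℂ ι ι), Matrix.trace,
    Fintype.sum_prod_type]
  refine Finset.sum_congr rfl fun i _ => Finset.sum_congr rfl fun j _ => ?_
  rw [Matrix.diag_apply, LinearMap.toMatrix_apply, Matrix.stdBasis_eq_single]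
  rfl

theorem trace_averageProj (hρ : Continuous ρ) (P Q : Matrix ι ι ℂ)
 :
    LinearMap.trace ℂ _ (averageProj hρ μ P Q) =
      ∫ g, (P * ρ g).trace * (Q * ρ g⁻¹).trace ∂μ := by
  rw [linearMap_trace_matrix]
  have h1 : ∀ i j, (averageProj hρ μ P Q) (Matrix.single i j 1) i j =
      ∫ g, (P * ρ g) i i * (ρ g⁻¹ * Q) j j ∂μ := by
    intro i j
    change (P * conjAverage μ ρ _ * Q) i j = _
    have := map_conjAverage (μ := μ) hρ ((Matrix.entryLinearMap ℂ ℂ i j) ∘ₗ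
      (LinearMap.mulRight ℂ Q) ∘ₗ (LinearMap.mulLeft ℂ P)) (Matrix.single i j 1)
    simp only [LinearMap.comp_apply, LinearMap.mulLeft_apply, LinearMap.mulRight_apply,
      Matrix.entryLinearMap_apply] at this
    rw [this]
    congr 1
    ext1 g
    rw [show P * (ρ g * Matrix.single i j 1 * ρ g⁻¹) * Q =
      (P * ρ g) * Matrix.single i j 1 * (ρ g⁻¹ * Q) by simp only [mul_assoc]]
    simp [Matrix.mul_apply, Matrix.single_apply, Finset.sum_mul, ite_and]
  have hc : ∀ i j, Continuous fun g => (P * ρ g) i i * (ρ g⁻¹ * Q) j j := fun i j => by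
    have h2 : Continuous fun g => P * ρ g := by fun_prop
    have h3 : Continuous fun g => ρ g⁻¹ * Q := by fun_prop
    exact (h2.matrix_elem i i).mul (h3.matrix_elem j j)
  simp_rw [h1]
  rw [Finset.sum_congr rfl fun i _ => (integral_finsetSum Finset.univ fun j _ =>
    integrable_of_continuous_of_compactSpace (hc i j)).symm,
    ← integral_finsetSum _ fun i _ => integrable_of_continuous_of_compactSpace
      (continuous_finsetSum _ fun j _ => hc i j)]
  congr 1
  ext1 g
  rw [Matrix.trace_mul_comm Q, Matrix.trace, Matrix.trace, Finset.sum_mul_sum]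
  rfl

/-- If the block of `ρ` cut out by a commuting idempotent `P` has a character of norm one, then
averages of conjugates act on the block as scalars. -/
theorem exists_smul_eq_of_norm_one [μ.IsMulLeftInvariant] (hρ : Continuous ρ) {P : Matrix ι ι ℂ}
    (hP : P * P = P) (hPρ : ∀ g, ρ g * P = P * ρ g)
    (h1 : ∫ g, (P * ρ g).trace * (P * ρ g⁻¹).trace ∂μ = 1) (T : Matrix ι ι ℂ) :
    ∃ c : ℂ, P * conjAverage μ ρ T * P = c • P := by
  have hproj := isProj_averageProj (μ := μ) hρ hP hP hPρ hPρ
  have htr := hproj.trace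
  rw [trace_averageProj hρ P P, h1] at htr
  have hfin : Module.finrank ℂ (commutantBlock ρ P P) = 1 := by exact_mod_cast htr.symm
  have hPmem : P ∈ commutantBlock ρ P P := ⟨hPρ, by rw [hP, hP]⟩
  have hP0 : P ≠ 0 := by
    rintro rfl
    simp at h1
  obtain ⟨c, hc⟩ := exists_smul_eq_of_finrank_eq_one hfin
    (x := (⟨P, hPmem⟩ : commutantBlock ρ P P)) (by simpa [Subtype.ext_iff] using hP0)
    ⟨_, hproj.map_mem T⟩
  exact ⟨c, (congrArg Subtype.val hc).symm⟩

theorem trace_ne_zero_of_norm_one {P : Matrix ι ι ℂ} (hP : P * P = P)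
    (h1 : ∫ g, (P * ρ g).trace * (P * ρ g⁻¹).trace ∂μ = 1) : P.trace ≠ 0 := by
  intro h0
  have hi : IsIdempotentElem (Matrix.toLin' P) := by
    rw [IsIdempotentElem, Module.End.mul_eq_comp, ← Matrix.toLin'_mul, hP]
  have := LinearMap.IsIdempotentElem.eq_zero_of_trace_eq_zero hi
    (by rw [Matrix.trace_toLin'_eq, h0])
  have hP0 : P = 0 := by simpa using this
  subst hP0
  simp at h1

/-- A continuous function satisfying the functional equation of a (multiple of a) normalized
irreducible character. -/
structure IsSpherical (μ : Measure G) (s : G → ℂ) : Prop where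
  continuous : Continuous s
  one_ne_zero : s 1 ≠ 0
  mul_comm : ∀ x y, s (x * y) = s (y * x)
  integral_conj : ∀ x y, s 1 * ∫ g, s (g * x * g⁻¹ * y) ∂μ = s x * s y

theorem isSpherical_of_norm_one [μ.IsMulLeftInvariant] (hρ : Continuous ρ) {P : Matrix ι ι ℂ}
    (hP : P * P = P) (hPρ : ∀ g, ρ g * P = P * ρ g)
    (h1 : ∫ g, (P * ρ g).trace * (P * ρ g⁻¹).trace ∂μ = 1) :
    IsSpherical μ fun g => (P * ρ g).trace where
  continuous := by fun_prop
  one_ne_zero := by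
    simpa using trace_ne_zero_of_norm_one hP h1
  mul_comm x y := by
    rw [map_mul, map_mul, ← mul_assoc, ← hPρ, mul_assoc, Matrix.trace_mul_comm, mul_assoc]
  integral_conj x y := by
    obtain ⟨c, hc⟩ := exists_smul_eq_of_norm_one hρ hP hPρ h1 (ρ x)
    have e1 : ∫ g, (P * ρ (g * x * g⁻¹ * y)).trace ∂μ = c * (P * ρ y).trace := by
      have h2 : ∀ g, (P * ρ (g * x * g⁻¹ * y)).trace =
          (ρ y * P * (ρ g * ρ x * ρ g⁻¹)).trace := fun g => by
        rw [map_mul, map_mul, map_mul, ← mul_assoc, Matrix.trace_mul_comm, ← mul_assoc]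
      simp_rw [h2]
      rw [← trace_mul_conjAverage hρ]
      have h3 : ρ y * P * conjAverage μ ρ (ρ x) = ρ y * (P * conjAverage μ ρ (ρ x) * P) := by
        have : P * conjAverage μ ρ (ρ x) = conjAverage μ ρ (ρ x) * P := by
          have := map_conjAverage (μ := μ) hρ (LinearMap.mulLeft ℂ P) (ρ x)
          have h' := map_conjAverage (μ := μ) hρ (LinearMap.mulRight ℂ P) (ρ x)
          simp only [LinearMap.mulLeft_apply, LinearMap.mulRight_apply] at this h'
          rw [this, h']
          congr 1
          ext1 g
          simp only [mul_assoc, hPρ]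
          simp only [← mul_assoc, hPρ]
        rw [this, mul_assoc _ P P, hP, ← this, mul_assoc]
      rw [h3, hc, hPρ y |> fun h => show ρ y * (c • P) = c • (P * ρ y) by rw [mul_smul_comm, h],
        Matrix.trace_smul, smul_eq_mul]
    have e2 : (P * ρ x).trace = c * P.trace := by
      have h2 : (P * conjAverage μ ρ (ρ x) * P).trace = (P * ρ x).trace := by
        rw [Matrix.trace_mul_comm, ← mul_assoc, hP, trace_mul_conjAverage hρ]
        have : ∀ g, (P * (ρ g * ρ x * ρ g⁻¹)).trace = (P * ρ x).trace := fun g => by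
          rw [← mul_assoc, Matrix.trace_mul_comm, ← mul_assoc P, ← hPρ, mul_assoc (ρ g),
            ← mul_assoc, ← map_mul]
          simp
        simp [this]
      rw [← h2, hc, Matrix.trace_smul, smul_eq_mul]
    rw [e1, e2, map_one, mul_one]
    ring

end Average

section Convolution

variable {μ : Measure G} [IsProbabilityMeasure μ]

theorem IsSpherical.convolution [μ.IsMulLeftInvariant] [μ.IsMulRightInvariant] {s f : G → ℂ}
    (hs : IsSpherical μ s)
    (hf : Continuous f) (hf' : ∀ x y, f (x * y) = f (y * x)) (x : G) :
    s 1 * ∫ g, f g⁻¹ * s (g * x) ∂μ = (∫ g, f g⁻¹ * s g ∂μ) * s x := by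
  have hsc := hs.continuous
  have h1 : ∀ h, ∫ g, f g⁻¹ * s (g * x) ∂μ = ∫ g, f g⁻¹ * s (h * g * h⁻¹ * x) ∂μ := by
    intro h
    rw [← integral_mul_left_eq_self _ h, ← integral_mul_right_eq_self _ h⁻¹]
    congr 1
    ext1 g
    congr 1
    · rw [← mul_assoc, _root_.mul_inv_rev, inv_inv, hf', _root_.mul_inv_rev]
      simp [mul_assoc]
    · simp only [mul_assoc]
  have h2 : ∫ g, f g⁻¹ * s (g * x) ∂μ = ∫ h, ∫ g, f g⁻¹ * s (h * g * h⁻¹ * x) ∂μ ∂μ := by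
    simp_rw [← h1]
    simp
  rw [h2, integral_swap_of_compactSpace (by fun_prop)]
  simp_rw [integral_const_mul]
  rw [← integral_const_mul, ← integral_mul_const]
  congr 1
  ext1 g
  rw [mul_left_comm, hs.integral_conj]
  ring

theorem IsSpherical.convolution' [μ.IsMulLeftInvariant] [μ.IsMulRightInvariant]
    [μ.IsInvInvariant] {s f : G → ℂ} (hs : IsSpherical μ s)
    (hf : Continuous f) (hf' : ∀ x y, f (x * y) = f (y * x)) (x : G) :
    s 1 * ∫ g, s g⁻¹ * f (g * x) ∂μ = (∫ g, s g⁻¹ * f g ∂μ) * s x := by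
  have h1 : ∫ g, s g⁻¹ * f (g * x) ∂μ = ∫ g, f g⁻¹ * s (g * x) ∂μ := by
    rw [← integral_mul_right_eq_self _ x⁻¹, ← integral_inv_eq_self]
    congr 1
    ext1 g
    rw [_root_.mul_inv_rev, inv_inv, inv_inv, hs.mul_comm, inv_mul_cancel_right, _root_.mul_comm]
  have h2 : ∫ g, s g⁻¹ * f g ∂μ = ∫ g, f g⁻¹ * s g ∂μ := by
    rw [← integral_inv_eq_self]
    simp_rw [inv_inv, _root_.mul_comm]
  rw [h1, h2, hs.convolution hf hf']

end Convolution

section Triangular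

variable {ι : Type*} [Fintype ι] [DecidableEq ι] {μ : Measure G} [IsProbabilityMeasure μ]
  [μ.IsMulLeftInvariant] [μ.IsMulRightInvariant] {ρ : G →* Matrix ι ι ℂ}

/-- The central projection of a representation `ρ` attached to a spherical function. -/
def centralProj (μ : Measure G) (ρ : G →* Matrix ι ι ℂ) (s : G → ℂ) : Matrix ι ι ℂ :=
  s 1 • ∫ g, s g⁻¹ • ρ g ∂μ

theorem mul_centralProj (hρ : Continuous ρ) {s : G → ℂ} (hs : Continuous s) (h : G) :
    ρ h * centralProj μ ρ s = s 1 • ∫ g, s (g⁻¹ * h) • ρ g ∂μ := by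
  have := map_integral_matrix (μ := μ) (LinearMap.mulLeft ℂ (ρ h))
    (f := fun g => s g⁻¹ • ρ g) (by fun_prop)
  simp only [LinearMap.mulLeft_apply] at this
  rw [centralProj, mul_smul_comm, this, ← integral_mul_left_eq_self _ h⁻¹]
  congr 2
  ext1 g
  rw [mul_smul_comm, ← map_mul, mul_inv_cancel_left, _root_.mul_inv_rev, inv_inv]

theorem centralProj_mul (hρ : Continuous ρ) {s : G → ℂ} (hs : Continuous s) (h : G) :
    centralProj μ ρ s * ρ h = s 1 • ∫ g, s (h * g⁻¹) • ρ g ∂μ := by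
  have := map_integral_matrix (μ := μ) (LinearMap.mulRight ℂ (ρ h))
    (f := fun g => s g⁻¹ • ρ g) (by fun_prop)
  simp only [LinearMap.mulRight_apply] at this
  rw [centralProj, smul_mul_assoc, this, ← integral_mul_right_eq_self _ h⁻¹]
  congr 2
  ext1 g
  rw [smul_mul_assoc, ← map_mul, inv_mul_cancel_right, _root_.mul_inv_rev, inv_inv]

theorem centralProj_commute (hρ : Continuous ρ) {s : G → ℂ} (hs : IsSpherical μ s) (h : G) :
    ρ h * centralProj μ ρ s = centralProj μ ρ s * ρ h := by
  rw [mul_centralProj hρ hs.continuous, centralProj_mul hρ hs.continuous]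
  simp_rw [hs.mul_comm h]

theorem trace_mul_centralProj_mul (hρ : Continuous ρ) {s : G → ℂ} (hs : Continuous s)
    (Q : Matrix ι ι ℂ) (x : G) : (Q * centralProj μ ρ s * ρ x).trace =
      s 1 * ∫ g, s g⁻¹ * (Q * ρ (g * x)).trace ∂μ := by
  have := map_integral_matrix (μ := μ) ((Matrix.traceLinearMap ι ℂ ℂ) ∘ₗ (LinearMap.mulLeft ℂ Q)
    ∘ₗ (LinearMap.mulRight ℂ (ρ x))) (f := fun g => s g⁻¹ • ρ g) (by fun_prop)
  simp only [LinearMap.comp_apply, LinearMap.mulRight_apply, LinearMap.mulLeft_apply,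
    Matrix.traceLinearMap_apply] at this
  rw [centralProj, mul_smul_comm, smul_mul_assoc, Matrix.trace_smul, smul_eq_mul, mul_assoc, this]
  simp [Matrix.trace_smul]

theorem mul_centralProj_of_commute (hρ : Continuous ρ) {s : G → ℂ} (hs : Continuous s)
    {Q : Matrix ι ι ℂ} (hQ : ∀ g, ρ g * Q = Q * ρ g) :
    Q * centralProj μ ρ s = centralProj μ ρ s * Q := by
  have h1 := map_integral_matrix (μ := μ) (LinearMap.mulLeft ℂ Q)
    (f := fun g => s g⁻¹ • ρ g) (by fun_prop)
  have h2 := map_integral_matrix (μ := μ) (LinearMap.mulRight ℂ Q)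
    (f := fun g => s g⁻¹ • ρ g) (by fun_prop)
  simp only [LinearMap.mulLeft_apply, LinearMap.mulRight_apply] at h1 h2
  rw [centralProj, mul_smul_comm, smul_mul_assoc, h1, h2]
  simp [hQ]

theorem centralProj_mul_centralProj (hρ : Continuous ρ) {s t : G → ℂ} (hs : IsSpherical μ s)
    (ht : IsSpherical μ t) :
    centralProj μ ρ s * centralProj μ ρ t =
      (s 1 * (∫ g, s g⁻¹ * t g ∂μ)) • ∫ g, t g⁻¹ • ρ g ∂μ := by
  have hsc := hs.continuous
  have htc := ht.continuous
  have h1 := map_integral_matrix (μ := μ) (LinearMap.mulRight ℂ (centralProj μ ρ t))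
    (f := fun g => s g⁻¹ • ρ g) (by fun_prop)
  simp only [LinearMap.mulRight_apply, smul_mul_assoc, mul_centralProj hρ htc] at h1
  rw [centralProj, smul_mul_assoc, h1, mul_smul]
  congr 1
  have h3 : ∀ g, s g⁻¹ • t 1 • ∫ x, t (x⁻¹ * g) • ρ x ∂μ =
      ∫ x, (t 1 * (s g⁻¹ * t (x⁻¹ * g))) • ρ x ∂μ := fun g => by
    rw [smul_smul, ← integral_smul]
    congr 1
    ext1 x
    rw [smul_smul]
    congr 1
    ring
  simp_rw [h3]
  rw [integral_swap_of_compactSpace (by fun_prop), ← integral_smul]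
  congr 1
  ext1 g
  have h2 := ht.convolution hsc hs.mul_comm g⁻¹
  calc ∫ x, (t 1 * (s x⁻¹ * t (g⁻¹ * x))) • ρ g ∂μ
      = (∫ x, (t 1 * (s x⁻¹ * t (g⁻¹ * x))) ∂μ) • ρ g := integral_smul_const _ _
    _ = _ := by
      simp_rw [ht.mul_comm g⁻¹]
      rw [integral_const_mul, h2, smul_smul]

/-- A class function of norm one which, modulo orthonormal spherical functions orthogonal to it, is
the character of a block of a representation, is itself spherical. -/
theorem isSpherical_of_triangular [μ.IsInvInvariant] {κ : Type*} [DecidableEq κ] (hρ : Continuous ρ)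
    (F : Finset κ) (s : κ → G → ℂ)
    (hs : ∀ k ∈ F, IsSpherical μ (s k))
    (horth : ∀ k ∈ F, ∀ l ∈ F, ∫ g, s k g⁻¹ * s l g ∂μ = if k = l then 1 else 0)
    {f : G → ℂ} (hf : Continuous f) (hf' : ∀ x y, f (x * y) = f (y * x))
    (hff : ∫ g, f g * f g⁻¹ ∂μ = 1) (hsf : ∀ k ∈ F, ∫ g, s k g⁻¹ * f g ∂μ = 0)
    (c : κ → ℂ) {Q : Matrix ι ι ℂ} (hQ : Q * Q = Q) (hQρ : ∀ g, ρ g * Q = Q * ρ g)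
    (htr : ∀ x, (Q * ρ x).trace = f x + ∑ k ∈ F, c k * s k x) : IsSpherical μ f := by
  set S : Matrix ι ι ℂ := ∑ k ∈ F, centralProj μ ρ (s k) with hS
  have hSρ : ∀ g, ρ g * S = S * ρ g := fun g => by
    rw [hS, Finset.mul_sum, Finset.sum_mul]
    exact Finset.sum_congr rfl fun k hk => centralProj_commute hρ (hs k hk) g
  have hQS : Q * S = S * Q := by
    rw [hS, Finset.mul_sum, Finset.sum_mul]
    exact Finset.sum_congr rfl fun k hk => mul_centralProj_of_commute hρ (hs k hk).continuous hQρ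
  have hSS : S * S = S := by
    rw [hS, Finset.sum_mul_sum]
    refine Finset.sum_congr rfl fun k hk => ?_
    rw [Finset.sum_eq_single_of_mem k hk]
    · rw [centralProj_mul_centralProj hρ (hs k hk) (hs k hk), horth k hk k hk, centralProj]
      simp
    · intro l hl hkl
      rw [centralProj_mul_centralProj hρ (hs k hk) (hs l hl), horth k hk l hl]
      simp [hkl.symm]
  have hfun : f = fun x => (Q * (1 - S) * ρ x).trace := by
    ext1 x
    have h1 : ∀ k ∈ F, (Q * centralProj μ ρ (s k) * ρ x).trace = c k * s k x := by
      intro k hk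
      have hkc := (hs k hk).continuous
      have hlc : ∀ l ∈ F, Continuous (s l) := fun l hl => (hs l hl).continuous
      rw [trace_mul_centralProj_mul hρ hkc]
      simp_rw [htr, mul_add, Finset.mul_sum]
      rw [integral_add, integral_finsetSum, mul_add, (hs k hk).convolution' hf hf', hsf k hk,
        Finset.mul_sum, Finset.sum_eq_single_of_mem k hk]
      · simp_rw [mul_left_comm _ (c k)]
        rw [integral_const_mul, mul_left_comm, (hs k hk).convolution' hkc (hs k hk).mul_comm,
          horth k hk k hk]
        simp
      · intro l hl hkl
        simp_rw [mul_left_comm _ (c l)]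
        rw [integral_const_mul, mul_left_comm, (hs k hk).convolution' (hlc l hl) (hs l hl).mul_comm,
          horth k hk l hl]
        simp [hkl.symm]
      · intro l hl
        have := hlc l hl
        exact integrable_of_continuous_of_compactSpace (by fun_prop)
      · exact integrable_of_continuous_of_compactSpace (by fun_prop)
      · refine integrable_of_continuous_of_compactSpace (continuous_finsetSum _ fun l hl => ?_)
        have := hlc l hl
        fun_prop
    rw [mul_sub, sub_mul, Matrix.trace_sub, mul_one, htr, hS, Finset.mul_sum, Finset.sum_mul,
      Matrix.trace_sum, Finset.sum_congr rfl h1, add_sub_cancel_right]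
  have hPP : Q * (1 - S) * (Q * (1 - S)) = Q * (1 - S) := by
    calc Q * (1 - S) * (Q * (1 - S)) = Q * (Q - S * Q) * (1 - S) := by noncomm_ring
      _ = (Q * Q) * ((1 - S) * (1 - S)) := by rw [← hQS]; noncomm_ring
      _ = Q * (1 - S) := by
        rw [hQ, show (1 - S) * (1 - S) = 1 - S - S + S * S by noncomm_ring, hSS]
        noncomm_ring
  rw [hfun]
  refine isSpherical_of_norm_one hρ hPP (fun g => ?_) ?_
  · rw [← mul_assoc, hQρ, mul_assoc, mul_sub, hSρ, mul_one, mul_assoc, sub_mul, one_mul]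
  · rw [hfun] at hff
    exact hff

end Triangular

end CompactGroup

section PolynomialRepresentation

variable {N : ℕ}

/-- Exponents of monomials of degree `d` in the entries of an `N × N` matrix. -/
abbrev ExpMat (N d : ℕ) : Type :=
  ↥(Finset.piAntidiag (Finset.univ : Finset (Fin N × Fin N)) d)

theorem mem_expMat {d : ℕ} {M : Fin N × Fin N → ℕ} :
    M ∈ Finset.piAntidiag (Finset.univ : Finset (Fin N × Fin N)) d ↔ ∑ p, M p = d := by
  simp

/-- Row sums of an exponent matrix. -/
def rowSum (M : Fin N × Fin N → ℕ) (i : Fin N) : ℕ := ∑ j, M (i, j)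

/-- Column sums of an exponent matrix. -/
def colSum (M : Fin N × Fin N → ℕ) (j : Fin N) : ℕ := ∑ i, M (i, j)

theorem sum_rowSum (M : Fin N × Fin N → ℕ) : ∑ i, rowSum M i = ∑ p, M p :=
  (Fintype.sum_prod_type _).symm

theorem sum_colSum (M : Fin N × Fin N → ℕ) : ∑ i, colSum M i = ∑ p, M p :=
  (Fintype.sum_prod_type_right _).symm

/-- The monomial with exponent `M` in the entries of `A`. -/
def entryMonomial (M : Fin N × Fin N → ℕ) (A : Matrix (Fin N) (Fin N) ℂ) : ℂ :=
  ∏ p, A p.1 p.2 ^ M p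

/-- The polynomial with given coefficients on monomials of degree `d`. -/
theorem eval_sum_monomial {d : ℕ} (c : ExpMat N d → ℂ) (A : Matrix (Fin N) (Fin N) ℂ) :
    MvPolynomial.eval (fun p : Fin N × Fin N => A p.1 p.2)
      (∑ M : ExpMat N d, MvPolynomial.monomial (Finsupp.equivFunOnFinite.symm M.1) (c M)) =
      ∑ M : ExpMat N d, entryMonomial M.1 A * c M := by
  simp only [map_sum, MvPolynomial.eval_monomial]
  refine Finset.sum_congr rfl fun M _ => ?_
  rw [Finsupp.prod_fintype _ _ (by simp), mul_comm]
  rfl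

theorem entryMonomial_linearIndependent {d : ℕ} {c c' : ExpMat N d → ℂ}
    (h : ∀ A, ∑ M, entryMonomial M.1 A * c M = ∑ M, entryMonomial M.1 A * c' M) : c = c' := by
  have h1 : ∑ M : ExpMat N d, MvPolynomial.monomial (Finsupp.equivFunOnFinite.symm M.1) (c M) =
      ∑ M : ExpMat N d, MvPolynomial.monomial (Finsupp.equivFunOnFinite.symm M.1) (c' M) := by
    refine MvPolynomial.funext fun x => ?_
    have := h (Matrix.of fun i j => x (i, j))
    rw [← eval_sum_monomial, ← eval_sum_monomial] at this
    exact this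
  funext M
  have h2 := congrArg (MvPolynomial.coeff (Finsupp.equivFunOnFinite.symm M.1)) h1
  simpa [MvPolynomial.coeff_sum, MvPolynomial.coeff_monomial, Subtype.coe_inj] using h2

/-- Left marginal of a three-dimensional array. -/
def leftMarginal (n : Fin N × Fin N → Fin N → ℕ) (p : Fin N × Fin N) : ℕ := ∑ j, n (p.1, j) p.2

/-- Right marginal of a three-dimensional array. -/
def rightMarginal (n : Fin N × Fin N → Fin N → ℕ) (p : Fin N × Fin N) : ℕ := ∑ i, n (i, p.2) p.1

/-- Three-dimensional arrays with prescribed middle marginal. -/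
def arrays (M : Fin N × Fin N → ℕ) : Finset (Fin N × Fin N → Fin N → ℕ) :=
  Fintype.piFinset fun p => Finset.piAntidiag Finset.univ (M p)

theorem mem_arrays {M : Fin N × Fin N → ℕ} {n : Fin N × Fin N → Fin N → ℕ} :
    n ∈ arrays M ↔ ∀ p, ∑ a, n p a = M p := by
  simp [arrays]

theorem rowSum_leftMarginal {M : Fin N × Fin N → ℕ} {n : Fin N × Fin N → Fin N → ℕ}
    (hn : n ∈ arrays M) : rowSum (leftMarginal n) = rowSum M := by
  funext i
  simp only [rowSum, leftMarginal, ← mem_arrays.1 hn]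
  exact Finset.sum_comm

theorem colSum_leftMarginal (n : Fin N × Fin N → Fin N → ℕ) :
    colSum (leftMarginal n) = rowSum (rightMarginal n) := by
  funext i
  simp only [colSum, rowSum, leftMarginal, rightMarginal]
  exact Finset.sum_comm

/-- The structure constants of the matrix coproduct on polynomials in matrix entries. -/
def coprodCoeff (M K M' : Fin N × Fin N → ℕ) : ℂ :=
  ∑ n ∈ arrays M' with leftMarginal n = M ∧ rightMarginal n = K,
    ∏ p, (Nat.multinomial Finset.univ (n p) : ℂ)

theorem coprodCoeff_ne_zero {M K M' : Fin N × Fin N → ℕ} (h : coprodCoeff M K M' ≠ 0) :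
    rowSum M = rowSum M' ∧ colSum M = rowSum K := by
  obtain ⟨n, hn, -⟩ := Finset.exists_ne_zero_of_sum_ne_zero h
  simp only [Finset.mem_filter] at hn
  obtain ⟨h1, rfl, rfl⟩ := hn
  exact ⟨rowSum_leftMarginal h1, colSum_leftMarginal n⟩

theorem entryMonomial_mul {d : ℕ} {M' : Fin N × Fin N → ℕ} (hM' : ∑ p, M' p = d)
    (A B : Matrix (Fin N) (Fin N) ℂ) :
    entryMonomial M' (A * B) = ∑ M : ExpMat N d, ∑ K : ExpMat N d,
      coprodCoeff M.1 K.1 M' * (entryMonomial M.1 A * entryMonomial K.1 B) := by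
  have h1 : entryMonomial M' (A * B) = ∑ n ∈ arrays M',
      (∏ p, (Nat.multinomial Finset.univ (n p) : ℂ)) *
        (entryMonomial (leftMarginal n) A * entryMonomial (rightMarginal n) B) := by
    simp only [entryMonomial, Matrix.mul_apply, Finset.sum_pow_eq_sum_piAntidiag]
    rw [Finset.prod_univ_sum]
    refine Finset.sum_congr rfl fun n _ => ?_
    rw [Finset.prod_mul_distrib]
    congr 1
    simp only [mul_pow, Finset.prod_mul_distrib, leftMarginal, rightMarginal,
      ← Finset.prod_pow_eq_pow_sum, Fintype.prod_prod_type]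
    congr 1
    · exact Finset.prod_congr rfl fun i _ => Finset.prod_comm
    · rw [Finset.prod_congr rfl fun i _ => Finset.prod_comm, Finset.prod_comm]
      exact Finset.prod_congr rfl fun i _ => Finset.prod_comm
  have h2 : ∀ M : ExpMat N d, ∀ K : ExpMat N d,
      coprodCoeff M.1 K.1 M' * (entryMonomial M.1 A * entryMonomial K.1 B) =
      ∑ n ∈ arrays M' with (leftMarginal n, rightMarginal n) = (M.1, K.1),
        (∏ p, (Nat.multinomial Finset.univ (n p) : ℂ)) *
        (entryMonomial (leftMarginal n) A * entryMonomial (rightMarginal n) B) := by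
    intro M K
    simp only [Prod.mk.injEq]
    rw [coprodCoeff, Finset.sum_mul]
    refine Finset.sum_congr rfl fun n hn => ?_
    simp only [Finset.mem_filter] at hn
    rw [hn.2.1, hn.2.2]
  simp_rw [h2]
  rw [h1]
  have h3 := Finset.sum_fiberwise_of_maps_to
    (s := arrays M') (t := Finset.piAntidiag (Finset.univ : Finset (Fin N × Fin N)) d ×ˢ
      Finset.piAntidiag (Finset.univ : Finset (Fin N × Fin N)) d)
    (g := fun n => (leftMarginal n, rightMarginal n))
    (fun n hn => by
      rw [Finset.mem_product, mem_expMat, mem_expMat, ← hM', ← sum_rowSum M',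
        ← rowSum_leftMarginal hn, sum_rowSum]
      exact ⟨rfl, by rw [← sum_rowSum, ← colSum_leftMarginal, sum_colSum]⟩)
    (fun n => (∏ p, (Nat.multinomial Finset.univ (n p) : ℂ)) *
        (entryMonomial (leftMarginal n) A * entryMonomial (rightMarginal n) B))
  rw [← h3, Finset.sum_product]
  rw [← Finset.sum_coe_sort]
  refine Finset.sum_congr rfl fun M _ => ?_
  rw [← Finset.sum_coe_sort]

theorem expMat_sum {d : ℕ} (M : ExpMat N d) : ∑ p, M.1 p = d := mem_expMat.1 M.2

/-- The matrix of the substitution `p(Z) ↦ p(Z * A)` on polynomials of degree `d`. -/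
def polyRepFun (d : ℕ) (A : Matrix (Fin N) (Fin N) ℂ) : Matrix (ExpMat N d) (ExpMat N d) ℂ :=
  Matrix.of fun M M' => ∑ K : ExpMat N d, coprodCoeff M.1 K.1 M'.1 * entryMonomial K.1 A

theorem entryMonomial_mul_polyRepFun {d : ℕ} (M' : ExpMat N d) (A B : Matrix (Fin N) (Fin N) ℂ) :
    entryMonomial M'.1 (A * B) =
      ∑ M : ExpMat N d, entryMonomial M.1 A * polyRepFun d B M M' := by
  rw [entryMonomial_mul (expMat_sum M')]
  simp only [polyRepFun, Matrix.of_apply, Finset.mul_sum]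
  refine Finset.sum_congr rfl fun M _ => Finset.sum_congr rfl fun K _ => ?_
  ring

theorem polyRepFun_eq_of {d : ℕ} {B : Matrix (Fin N) (Fin N) ℂ}
    {T : Matrix (ExpMat N d) (ExpMat N d) ℂ}
    (h : ∀ A, ∀ M' : ExpMat N d, entryMonomial M'.1 (A * B) =
      ∑ M : ExpMat N d, entryMonomial M.1 A * T M M') : polyRepFun d B = T := by
  ext M M'
  refine congrFun (entryMonomial_linearIndependent (c := fun M => polyRepFun d B M M')
    (c' := fun M => T M M') fun A => ?_) M
  rw [← entryMonomial_mul_polyRepFun, h]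

theorem entryMonomial_mul_diagonal (M : Fin N × Fin N → ℕ) (A : Matrix (Fin N) (Fin N) ℂ)
    (x : Fin N → ℂ) : entryMonomial M (A * Matrix.diagonal x) =
      entryMonomial M A * ∏ j, x j ^ colSum M j := by
  simp only [entryMonomial, Matrix.mul_diagonal, mul_pow, Finset.prod_mul_distrib]
  congr 1
  rw [Fintype.prod_prod_type_right]
  refine Finset.prod_congr rfl fun j _ => ?_
  exact Finset.prod_pow_eq_pow_sum Finset.univ (fun i => M (i, j)) (x j)

theorem polyRepFun_diagonal (d : ℕ) (x : Fin N → ℂ) : polyRepFun d (Matrix.diagonal x) =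
    Matrix.diagonal fun M : ExpMat N d => ∏ j, x j ^ colSum M.1 j :=
  polyRepFun_eq_of fun A M' => by
    rw [entryMonomial_mul_diagonal]
    simp [Matrix.diagonal_apply]

/-- The representation of the monoid of matrices on polynomials of degree `d` in matrix entries. -/
def polyRep (N d : ℕ) : Matrix (Fin N) (Fin N) ℂ →* Matrix (ExpMat N d) (ExpMat N d) ℂ where
  toFun := polyRepFun d
  map_one' := by
    rw [← Matrix.diagonal_one, polyRepFun_diagonal]
    simp
  map_mul' A B := polyRepFun_eq_of fun Z M' => by
    simp only [← mul_assoc Z, entryMonomial_mul_polyRepFun _ (Z * A) B,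
      entryMonomial_mul_polyRepFun _ Z A, Matrix.mul_apply, Finset.mul_sum, Finset.sum_mul]
    rw [Finset.sum_comm]
    simp only [mul_assoc]

theorem polyRep_apply {d : ℕ} (A : Matrix (Fin N) (Fin N) ℂ) (M M' : ExpMat N d) :
    polyRep N d A M M' = ∑ K : ExpMat N d, coprodCoeff M.1 K.1 M'.1 * entryMonomial K.1 A := rfl

theorem entryMonomial_mul_polyRep {d : ℕ} (M' : ExpMat N d) (A B : Matrix (Fin N) (Fin N) ℂ) :
    entryMonomial M'.1 (A * B) = ∑ M : ExpMat N d, entryMonomial M.1 A * polyRep N d B M M' :=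
  entryMonomial_mul_polyRepFun M' A B

theorem polyRep_diagonal (d : ℕ) (x : Fin N → ℂ) : polyRep N d (Matrix.diagonal x) =
    Matrix.diagonal fun M : ExpMat N d => ∏ j, x j ^ colSum M.1 j :=
  polyRepFun_diagonal d x

theorem entryMonomial_smul {d : ℕ} (M : ExpMat N d) (c : ℂ) (A : Matrix (Fin N) (Fin N) ℂ) :
    entryMonomial M.1 (c • A) = c ^ d * entryMonomial M.1 A := by
  simp [entryMonomial, mul_pow, Finset.prod_mul_distrib, Finset.prod_pow_eq_pow_sum, expMat_sum]

theorem polyRep_smul (d : ℕ) (c : ℂ) (A : Matrix (Fin N) (Fin N) ℂ) :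
    polyRep N d (c • A) = c ^ d • polyRep N d A := by
  ext M M'
  simp only [polyRep_apply, Matrix.smul_apply, smul_eq_mul, entryMonomial_smul, Finset.mul_sum]
  refine Finset.sum_congr rfl fun K _ => ?_
  ring

theorem continuous_entryMonomial (M : Fin N × Fin N → ℕ) : Continuous (entryMonomial M) := by
  unfold entryMonomial
  fun_prop

theorem continuous_polyRep (d : ℕ) : Continuous (polyRep N d) := by
  refine continuous_matrix fun M M' => ?_
  simp only [polyRep_apply]
  exact continuous_finsetSum _ fun K _ => continuous_const.mul (continuous_entryMonomial _)

/-- The projection onto polynomials with row degrees `k`. -/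
def rowProj (d : ℕ) (k : Fin N → ℕ) : Matrix (ExpMat N d) (ExpMat N d) ℂ :=
  Matrix.diagonal fun M => if rowSum M.1 = k then 1 else 0

theorem rowProj_mul_self (d : ℕ) (k : Fin N → ℕ) : rowProj d k * rowProj d k = rowProj d k := by
  simp [rowProj, Matrix.diagonal_mul_diagonal]

theorem polyRep_mul_rowProj (d : ℕ) (k : Fin N → ℕ) (A : Matrix (Fin N) (Fin N) ℂ) :
    polyRep N d A * rowProj d k = rowProj d k * polyRep N d A := by
  ext M M'
  rw [rowProj, Matrix.mul_diagonal, Matrix.diagonal_mul, polyRep_apply]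
  by_cases h : rowSum M.1 = rowSum M'.1
  · rw [h, mul_comm]
  · have : ∀ K : ExpMat N d, coprodCoeff M.1 K.1 M'.1 = 0 := fun K => by
      by_contra h0
      exact h (coprodCoeff_ne_zero h0).1
    simp [this]

/-- The commutant element attached to an exponent matrix. -/
def commutantElem {d : ℕ} (M : ExpMat N d) : Matrix (ExpMat N d) (ExpMat N d) ℂ :=
  Matrix.of fun K M' => coprodCoeff M.1 K.1 M'.1

theorem sum_commutantElem {d : ℕ} (A B : Matrix (Fin N) (Fin N) ℂ) (M' : ExpMat N d) :
    entryMonomial M'.1 (A * B) =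
      ∑ M : ExpMat N d, entryMonomial M.1 A *
        ∑ K : ExpMat N d, entryMonomial K.1 B * commutantElem M K M' := by
  rw [entryMonomial_mul (expMat_sum M')]
  simp only [commutantElem, Matrix.of_apply, Finset.mul_sum]
  refine Finset.sum_congr rfl fun M _ => Finset.sum_congr rfl fun K _ => ?_
  ring

theorem commutantElem_commute {d : ℕ} (M : ExpMat N d) (A : Matrix (Fin N) (Fin N) ℂ) :
    polyRep N d A * commutantElem M = commutantElem M * polyRep N d A := by
  ext K M'
  have h1 : ∀ Y, (fun M : ExpMat N d => ∑ K : ExpMat N d, entryMonomial K.1 Y *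
      (commutantElem M * polyRep N d A) K M') = fun M => ∑ K : ExpMat N d,
        entryMonomial K.1 Y * (polyRep N d A * commutantElem M) K M' := by
    intro Y
    refine entryMonomial_linearIndependent fun Z => ?_
    have e1 := entryMonomial_mul_polyRep M' (Z * Y) A
    have e2 := sum_commutantElem Z (Y * A) M'
    rw [← mul_assoc, e1] at e2
    simp only [sum_commutantElem Z Y, entryMonomial_mul_polyRep _ Y A] at e2
    convert e2 using 1
    · simp only [Matrix.mul_apply, Finset.mul_sum, Finset.sum_mul]
      rw [Finset.sum_comm_cycle]
      simp only [mul_assoc]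
    · refine Finset.sum_congr rfl fun M _ => ?_
      simp only [Matrix.mul_apply, Finset.mul_sum, Finset.sum_mul]
      rw [Finset.sum_comm]
      simp only [mul_assoc]
  exact (congrFun (entryMonomial_linearIndependent fun Y => congrFun (h1 Y) M) K).symm

/-- The composition of an endomorphism with evaluation at the identity. -/
def evalOne {d : ℕ} : Matrix (ExpMat N d) (ExpMat N d) ℂ →ₗ[ℂ] (ExpMat N d → ℂ) where
  toFun T M := ∑ K : ExpMat N d, entryMonomial K.1 1 * T K M
  map_add' S T := by
    ext M
    simp [mul_add, Finset.sum_add_distrib]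
  map_smul' c T := by
    ext M
    simp [Finset.mul_sum, mul_left_comm]

theorem evalOne_apply {d : ℕ} (T : Matrix (ExpMat N d) (ExpMat N d) ℂ) (M : ExpMat N d) :
    evalOne T M = ∑ K : ExpMat N d, entryMonomial K.1 1 * T K M := rfl

theorem evalOne_commutantElem {d : ℕ} (M M' : ExpMat N d) :
    evalOne (commutantElem M) M' = if M = M' then 1 else 0 := by
  refine congrFun (entryMonomial_linearIndependent (c := fun M => evalOne (commutantElem M) M')
    (c' := fun M => if M = M' then 1 else 0) fun A => ?_) M
  simp only [evalOne_apply]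
  rw [← sum_commutantElem]
  simp

theorem eq_sum_commutantElem {d : ℕ} {T : Matrix (ExpMat N d) (ExpMat N d) ℂ}
    (hT : ∀ A, polyRep N d A * T = T * polyRep N d A) :
    T = ∑ M, evalOne T M • commutantElem M := by
  ext K M'
  refine congrFun (entryMonomial_linearIndependent (c := fun K => T K M')
    (c' := fun K => (∑ M, evalOne T M • commutantElem M) K M') fun A => ?_) K
  have h1 : ∀ K : ExpMat N d, entryMonomial K.1 A =
      ∑ J : ExpMat N d, entryMonomial J.1 1 * polyRep N d A J K := fun K => by
    rw [← entryMonomial_mul_polyRep, one_mul]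
  calc ∑ K : ExpMat N d, entryMonomial K.1 A * T K M'
      = ∑ J : ExpMat N d, entryMonomial J.1 1 * (polyRep N d A * T) J M' := by
        simp only [h1, Matrix.mul_apply, Finset.mul_sum, Finset.sum_mul]
        rw [Finset.sum_comm]
        simp only [mul_assoc]
    _ = ∑ M : ExpMat N d, evalOne T M * polyRep N d A M M' := by
        rw [hT]
        simp only [evalOne_apply, Matrix.mul_apply, Finset.mul_sum, Finset.sum_mul]
        rw [Finset.sum_comm]
        simp only [mul_assoc]
    _ = _ := by
        simp only [Matrix.sum_apply, Matrix.smul_apply, smul_eq_mul, polyRep_apply,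
          Finset.mul_sum, commutantElem, Matrix.of_apply]
        rw [Finset.sum_comm]
        refine Finset.sum_congr rfl fun M _ => Finset.sum_congr rfl fun K _ => ?_
        ring

/-- The number of exponent matrices with row sums `l` and column sums `k`. -/
def numExpMat (d : ℕ) (k l : Fin N → ℕ) : ℕ :=
  Fintype.card {M : ExpMat N d // rowSum M.1 = l ∧ colSum M.1 = k}

theorem rowProj_mul_apply_mul (d : ℕ) (k l : Fin N → ℕ) (T : Matrix (ExpMat N d) (ExpMat N d) ℂ)
    (K M : ExpMat N d) : (rowProj d k * T * rowProj d l) K M =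
      if rowSum K.1 = k ∧ rowSum M.1 = l then T K M else 0 := by
  rw [rowProj, rowProj, Matrix.mul_diagonal, Matrix.diagonal_mul]
  split_ifs <;> simp_all

theorem finrank_commutantBlock {G : Type*} [Group G] (d : ℕ) (k l : Fin N → ℕ)
    (ρ : G →* Matrix (ExpMat N d) (ExpMat N d) ℂ)
    (hρ : ∀ T, (∀ g, ρ g * T = T * ρ g) ↔ ∀ A, polyRep N d A * T = T * polyRep N d A) :
    Module.finrank ℂ (commutantBlock ρ (rowProj d k) (rowProj d l)) = numExpMat d k l := by
  let e : commutantBlock ρ (rowProj d k) (rowProj d l) ≃ₗ[ℂ]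
      ({M : ExpMat N d // rowSum M.1 = l ∧ colSum M.1 = k} → ℂ) :=
    LinearEquiv.ofBijective
      ((LinearMap.funLeft ℂ ℂ (Subtype.val :
        {M : ExpMat N d // rowSum M.1 = l ∧ colSum M.1 = k} → ExpMat N d)) ∘ₗ
          evalOne ∘ₗ Submodule.subtype _) (by
      constructor
      · rw [← LinearMap.ker_eq_bot, LinearMap.ker_eq_bot']
        rintro ⟨T, hT1, hT2⟩ h0
        rw [hρ] at hT1
        have hM : ∀ M : ExpMat N d, evalOne T M • (rowProj d k * commutantElem M * rowProj d l)
            = 0 := by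
          intro M
          by_cases hM : rowSum M.1 = l ∧ colSum M.1 = k
          · have := congrFun h0 ⟨M, hM⟩
            simp only [LinearMap.comp_apply, LinearMap.funLeft_apply, Submodule.subtype_apply,
              Pi.zero_apply] at this
            rw [this, zero_smul]
          · have : rowProj d k * commutantElem M * rowProj d l = 0 := by
              ext K M'
              rw [rowProj_mul_apply_mul]
              simp only [Matrix.zero_apply, ite_eq_right_iff, and_imp]
              intro h1 h2
              by_contra h3
              obtain ⟨h4, h5⟩ := coprodCoeff_ne_zero h3
              exact hM ⟨by rw [h4, h2], by rw [h5, h1]⟩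
            rw [this, smul_zero]
        have h3 : T = 0 := by
          rw [← hT2, eq_sum_commutantElem hT1, Finset.mul_sum, Finset.sum_mul]
          exact Finset.sum_eq_zero fun M _ => by rw [mul_smul_comm, smul_mul_assoc, hM]
        exact Subtype.ext h3
      · intro ψ
        refine ⟨⟨∑ M, ψ M • commutantElem M.1, ?_, ?_⟩, ?_⟩
        · rw [hρ]
          intro A
          simp [Finset.mul_sum, Finset.sum_mul, commutantElem_commute]
        · rw [Finset.mul_sum, Finset.sum_mul]
          refine Finset.sum_congr rfl fun M _ => ?_
          rw [mul_smul_comm, smul_mul_assoc]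
          congr 1
          ext K M'
          rw [rowProj_mul_apply_mul]
          split_ifs with h
          · rfl
          · by_contra h3
            obtain ⟨h4, h5⟩ := coprodCoeff_ne_zero (Ne.symm h3)
            exact h ⟨by rw [← h5, M.2.2], by rw [← h4, M.2.1]⟩
        · ext M
          simp [LinearMap.funLeft_apply, evalOne_commutantElem, Subtype.coe_inj])
  rw [e.finrank_eq, Module.finrank_fintype_fun_eq_card, numExpMat]

end PolynomialRepresentation

section PolynomialFunctions

variable {N : ℕ}

/-- Functions on matrices which are polynomial along polynomial curves. -/
def IsPolyFun (f : Matrix (Fin N) (Fin N) ℂ → ℂ) : Prop :=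
  ∀ P : Matrix (Fin N) (Fin N) (Polynomial ℂ), ∃ q : Polynomial ℂ,
    ∀ z, f (P.map (Polynomial.evalRingHom z)) = q.eval z

theorem isPolyFun_const (c : ℂ) : IsPolyFun fun _ : Matrix (Fin N) (Fin N) ℂ => c :=
  fun _ => ⟨Polynomial.C c, by simp⟩

theorem isPolyFun_entry (i j : Fin N) : IsPolyFun fun A => A i j :=
  fun P => ⟨P i j, by simp⟩

theorem IsPolyFun.mul {f g : Matrix (Fin N) (Fin N) ℂ → ℂ} (hf : IsPolyFun f) (hg : IsPolyFun g) :
    IsPolyFun fun A => f A * g A := fun P => by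
  obtain ⟨p, hp⟩ := hf P
  obtain ⟨q, hq⟩ := hg P
  exact ⟨p * q, fun z => by simp only [hp, hq, Polynomial.eval_mul]⟩

theorem IsPolyFun.sub {f g : Matrix (Fin N) (Fin N) ℂ → ℂ} (hf : IsPolyFun f) (hg : IsPolyFun g) :
    IsPolyFun fun A => f A - g A := fun P => by
  obtain ⟨p, hp⟩ := hf P
  obtain ⟨q, hq⟩ := hg P
  exact ⟨p - q, fun z => by simp only [hp, hq, Polynomial.eval_sub]⟩

theorem IsPolyFun.pow {f : Matrix (Fin N) (Fin N) ℂ → ℂ} (hf : IsPolyFun f) (n : ℕ) :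
    IsPolyFun fun A => f A ^ n := fun P => by
  obtain ⟨p, hp⟩ := hf P
  exact ⟨p ^ n, fun z => by simp only [hp, Polynomial.eval_pow]⟩

theorem IsPolyFun.sum {κ : Type*} (s : Finset κ) {f : κ → Matrix (Fin N) (Fin N) ℂ → ℂ}
    (hf : ∀ k ∈ s, IsPolyFun (f k)) : IsPolyFun fun A => ∑ k ∈ s, f k A := fun P => by
  choose! p hp using fun k hk => hf k hk P
  exact ⟨∑ k ∈ s, p k, fun z => by
    rw [Polynomial.eval_finsetSum]
    exact Finset.sum_congr rfl fun k hk => hp k hk z⟩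

theorem IsPolyFun.prod {κ : Type*} (s : Finset κ) {f : κ → Matrix (Fin N) (Fin N) ℂ → ℂ}
    (hf : ∀ k ∈ s, IsPolyFun (f k)) : IsPolyFun fun A => ∏ k ∈ s, f k A := fun P => by
  choose! p hp using fun k hk => hf k hk P
  exact ⟨∏ k ∈ s, p k, fun z => by
    rw [Polynomial.eval_prod]
    exact Finset.prod_congr rfl fun k hk => hp k hk z⟩

theorem IsPolyFun.det {n : ℕ} {F : Matrix (Fin N) (Fin N) ℂ → Matrix (Fin n) (Fin n) ℂ}
    (hF : ∀ i j, IsPolyFun fun A => F A i j) : IsPolyFun fun A => (F A).det := by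
  simp only [Matrix.det_apply']
  exact IsPolyFun.sum _ fun w _ => (isPolyFun_const _).mul (IsPolyFun.prod _ fun i _ => hF _ _)

theorem isPolyFun_det : IsPolyFun (Matrix.det : Matrix (Fin N) (Fin N) ℂ → ℂ) :=
  IsPolyFun.det isPolyFun_entry

theorem isPolyFun_pow_trace (m : ℕ) :
    IsPolyFun fun A : Matrix (Fin N) (Fin N) ℂ => (A ^ m).trace := fun P => by
  refine ⟨(P ^ m).trace, fun z => ?_⟩
  rw [← Polynomial.coe_evalRingHom, AddMonoidHom.map_trace]
  exact congrArg Matrix.trace (map_pow (Polynomial.evalRingHom z).mapMatrix P m).symm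

theorem isPolyFun_trace_polyRep {d : ℕ} (C : Matrix (ExpMat N d) (ExpMat N d) ℂ) :
    IsPolyFun fun A => (C * polyRep N d A).trace := by
  simp only [Matrix.trace, Matrix.diag_apply, Matrix.mul_apply, polyRep_apply, entryMonomial]
  exact IsPolyFun.sum _ fun _ _ => IsPolyFun.sum _ fun _ _ => (isPolyFun_const _).mul <|
    IsPolyFun.sum _ fun _ _ => (isPolyFun_const _).mul <| IsPolyFun.prod _ fun _ _ =>
      (isPolyFun_entry _ _).pow _

theorem IsPolyFun.comp_cayley {f : Matrix (Fin N) (Fin N) ℂ → ℂ} (hf : IsPolyFun f) :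
    IsPolyFun fun X => f ((1 + Complex.I • X) * (1 - Complex.I • X).adjugate) := fun P => by
  obtain ⟨q, hq⟩ := hf ((1 + Polynomial.C Complex.I • P) *
    (1 - Polynomial.C Complex.I • P).adjugate)
  refine ⟨q, fun z => ?_⟩
  rw [← hq]
  refine congrArg f ?_
  have h1 : (Polynomial.C Complex.I • P).map (Polynomial.evalRingHom z) =
      Complex.I • P.map (Polynomial.evalRingHom z) := by
    ext i j
    simp
  rw [← RingHom.mapMatrix_apply] at h1
  rw [← RingHom.mapMatrix_apply, ← RingHom.mapMatrix_apply, map_mul, RingHom.map_adjugate,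
    map_add, map_sub, map_one, h1, RingHom.mapMatrix_apply]

theorem Polynomial.eq_zero_of_infinite_setOf_eval_eq_zero {q : Polynomial ℂ} {s : Set ℂ}
    (hs : s.Infinite)
    (h : ∀ z ∈ s, q.eval z = 0) : q = 0 :=
  Polynomial.eq_zero_of_infinite_isRoot q (hs.mono fun z hz => h z hz)

theorem IsPolyFun.eq_zero_of_isHermitian {f : Matrix (Fin N) (Fin N) ℂ → ℂ} (hf : IsPolyFun f)
    (h : ∀ H, H.IsHermitian → f H = 0) (A : Matrix (Fin N) (Fin N) ℂ) : f A = 0 := by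
  have h1 : ((realPart A : selfAdjoint _) : Matrix (Fin N) (Fin N) ℂ).IsHermitian :=
    (realPart A).2
  have h2 : ((imaginaryPart A : selfAdjoint _) : Matrix (Fin N) (Fin N) ℂ).IsHermitian :=
    (imaginaryPart A).2
  set R : Matrix (Fin N) (Fin N) ℂ := ((realPart A : selfAdjoint _) : Matrix (Fin N) (Fin N) ℂ)
  set J : Matrix (Fin N) (Fin N) ℂ :=
    ((imaginaryPart A : selfAdjoint _) : Matrix (Fin N) (Fin N) ℂ)
  obtain ⟨q, hq⟩ := hf (R.map Polynomial.C + (Polynomial.X : Polynomial ℂ) • J.map Polynomial.C)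
  have h3 : ∀ z : ℂ, (R.map Polynomial.C + (Polynomial.X : Polynomial ℂ) • J.map Polynomial.C).map
      (Polynomial.evalRingHom z) = R + z • J := fun z => by
    ext i j
    simp [mul_comm z]
  simp only [h3] at hq
  have h4 : q = 0 := by
    refine Polynomial.eq_zero_of_infinite_setOf_eval_eq_zero
      (Set.infinite_range_of_injective Complex.ofReal_injective) ?_
    rintro _ ⟨x, rfl⟩
    rw [← hq]
    refine h _ (h1.add ?_)
    rw [Matrix.IsHermitian, Matrix.conjTranspose_smul, h2.eq]
    simp
  have h5 : A = R + Complex.I • J := (realPart_add_I_smul_imaginaryPart A).symm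
  rw [h5, hq, h4, Polynomial.eval_zero]

theorem IsPolyFun.eq_zero_of_det_ne_zero {f : Matrix (Fin N) (Fin N) ℂ → ℂ} (hf : IsPolyFun f)
    (h : ∀ A : Matrix (Fin N) (Fin N) ℂ, (A + 1).det ≠ 0 → f A = 0)
    (A : Matrix (Fin N) (Fin N) ℂ) : f A = 0 := by
  obtain ⟨q, hq⟩ := hf (A.map Polynomial.C + Matrix.scalar (Fin N) (Polynomial.X : Polynomial ℂ))
  have h3 : ∀ z : ℂ, (A.map Polynomial.C + Matrix.scalar (Fin N) (Polynomial.X : Polynomial ℂ)).map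
      (Polynomial.evalRingHom z) = A + Matrix.scalar (Fin N) z := fun z => by
    ext i j
    by_cases hij : i = j <;> simp [hij]
  simp only [h3] at hq
  have h4 : q = 0 := by
    have hfin : {z : ℂ | (-(A + 1)).charpoly.IsRoot z}.Finite :=
      Polynomial.finite_setOfPred_isRoot (Matrix.charpoly_monic _).ne_zero
    refine Polynomial.eq_zero_of_infinite_setOf_eval_eq_zero hfin.infinite_compl fun z hz => ?_
    rw [← hq]
    refine h _ fun h0 => hz ?_
    change Polynomial.eval z _ = 0
    rw [Matrix.eval_charpoly, ← h0]
    congr 1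
    abel
  have := hq 0
  rw [h4] at this
  simpa using this

open scoped ComplexOrder in
theorem det_one_sub_I_smul_ne_zero {H : Matrix (Fin N) (Fin N) ℂ} (hH : H.IsHermitian) :
    (1 - Complex.I • H).det ≠ 0 := by
  have h1 : (1 + Complex.I • H) * (1 - Complex.I • H) = 1 + Hᴴ * H := by
    have h : (Complex.I • H) * (Complex.I • H) = -(H * H) := by
      simp [smul_smul]
    rw [hH.eq, mul_sub, mul_one, add_mul, one_mul, h]
    abel
  have h2 : (1 + Hᴴ * H).PosDef := Matrix.PosDef.one.add_posSemidef
    (Matrix.posSemidef_conjTranspose_mul_self H)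
  have h3 := h2.det_pos.ne'
  rw [← h1, Matrix.det_mul] at h3
  exact right_ne_zero_of_mul h3

/-- The Cayley transform of a Hermitian matrix is, up to scaling, unitary. -/
theorem cayley_mem_unitaryGroup {H : Matrix (Fin N) (Fin N) ℂ} (hH : H.IsHermitian) :
    (1 - Complex.I • H).det⁻¹ • ((1 + Complex.I • H) * (1 - Complex.I • H).adjugate) ∈
      Matrix.unitaryGroup (Fin N) ℂ := by
  have h0 := det_one_sub_I_smul_ne_zero hH
  have h1 : (1 - Complex.I • H)ᴴ = 1 + Complex.I • H := by
    simp [Matrix.conjTranspose_smul, hH.eq]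
  have h2 : (1 + Complex.I • H)ᴴ = 1 - Complex.I • H := by
    rw [← h1, Matrix.conjTranspose_conjTranspose]
  have h3 : (1 + Complex.I • H) * (1 - Complex.I • H) =
      (1 - Complex.I • H) * (1 + Complex.I • H) := by
    generalize Complex.I • H = K
    noncomm_ring
  rw [Matrix.mem_unitaryGroup_iff', Matrix.star_eq_conjTranspose, Matrix.conjTranspose_smul,
    Matrix.conjTranspose_mul, h2, Matrix.adjugate_conjTranspose, h1, smul_mul_smul_comm,
    show (1 + Complex.I • H).adjugate * (1 - Complex.I • H) *
      ((1 + Complex.I • H) * (1 - Complex.I • H).adjugate) =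
      (1 + Complex.I • H).adjugate * ((1 - Complex.I • H) * (1 + Complex.I • H)) *
        (1 - Complex.I • H).adjugate by simp only [mul_assoc], ← h3,
    show (1 + Complex.I • H).adjugate * ((1 + Complex.I • H) * (1 - Complex.I • H)) *
        (1 - Complex.I • H).adjugate = ((1 + Complex.I • H).adjugate * (1 + Complex.I • H)) *
        ((1 - Complex.I • H) * (1 - Complex.I • H).adjugate) by simp only [mul_assoc],
    Matrix.adjugate_mul, Matrix.mul_adjugate, smul_mul_smul_comm, smul_smul, mul_one, ← h1,
    Matrix.det_conjTranspose]
  rw [star_inv₀, mul_mul_mul_comm, inv_mul_cancel₀ h0, inv_mul_cancel₀ (star_ne_zero.2 h0),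
    one_mul, one_smul]

/-- A homogeneous polynomial function vanishing on the unitary group vanishes. -/
theorem IsPolyFun.eq_zero_of_unitary {f : Matrix (Fin N) (Fin N) ℂ → ℂ} (hf : IsPolyFun f)
    {d : ℕ} (hd : ∀ c A, f (c • A) = c ^ d * f A) (h : ∀ U ∈ Matrix.unitaryGroup (Fin N) ℂ, f U = 0)
    (A : Matrix (Fin N) (Fin N) ℂ) : f A = 0 := by
  have h1 : ∀ X, f ((1 + Complex.I • X) * (1 - Complex.I • X).adjugate) = 0 :=
    hf.comp_cayley.eq_zero_of_isHermitian fun H hH => by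
      have := h _ (cayley_mem_unitaryGroup hH)
      rw [hd] at this
      exact (mul_eq_zero.1 this).resolve_left
        (pow_ne_zero _ (inv_ne_zero (det_one_sub_I_smul_ne_zero hH)))
  refine hf.eq_zero_of_det_ne_zero (fun A hA => ?_) A
  have h2 : (A + 1) * (A + 1)⁻¹ = 1 := Matrix.mul_nonsing_inv _ (isUnit_iff_ne_zero.2 hA)
  have h3 := h1 (-Complex.I • ((A - 1) * (A + 1)⁻¹))
  simp only [smul_smul, mul_neg, Complex.I_mul_I, neg_neg, one_smul] at h3
  have h4 : 1 - (A - 1) * (A + 1)⁻¹ = (2 : ℂ) • (A + 1)⁻¹ := by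
    rw [show (A - 1) * (A + 1)⁻¹ = (A + 1) * (A + 1)⁻¹ - (2 : ℂ) • (A + 1)⁻¹ by
      rw [two_smul]; noncomm_ring, h2, sub_sub_cancel]
  have h5 : 1 + (A - 1) * (A + 1)⁻¹ = A * (1 - (A - 1) * (A + 1)⁻¹) := by
    rw [h4, show (A - 1) * (A + 1)⁻¹ = (2 : ℂ) • (A * (A + 1)⁻¹) - (A + 1) * (A + 1)⁻¹ by
      rw [two_smul]; noncomm_ring, h2, add_sub_cancel, mul_smul_comm]
  rw [h5, mul_assoc, Matrix.mul_adjugate, mul_smul_comm, mul_one, hd, h4] at h3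
  refine (mul_eq_zero.1 h3).resolve_left (pow_ne_zero _ ?_)
  rw [Matrix.det_smul, Matrix.det_nonsing_inv]
  simp [hA]

theorem exists_smul_mem_SUN (hN : 1 ≤ N) {U : Matrix (Fin N) (Fin N) ℂ}
    (hU : U ∈ Matrix.unitaryGroup (Fin N) ℂ) :
    ∃ (c : ℂ) (V : SUN N), U = c • ((V : UN N) : Matrix (Fin N) (Fin N) ℂ) := by
  obtain ⟨c, hc⟩ := IsAlgClosed.exists_pow_nat_eq U.det hN
  have hdet : star U.det * U.det = 1 := by
    rw [← Matrix.det_conjTranspose, ← Matrix.det_mul, ← Matrix.star_eq_conjTranspose,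
      Matrix.mem_unitaryGroup_iff'.1 hU, Matrix.det_one]
  have hc1 : star c * c = 1 := by
    rw [← hc, star_pow, ← mul_pow] at hdet
    have h1 : star c * c = ((‖c‖ ^ 2 : ℝ) : ℂ) := by
      rw [Complex.star_def, ← Complex.normSq_eq_conj_mul_self, Complex.normSq_eq_norm_sq]
    rw [h1] at hdet ⊢
    norm_cast at hdet ⊢
    exact (pow_eq_one_iff_of_nonneg (by positivity) (by omega)).1 hdet
  have hc0 : c ≠ 0 := right_ne_zero_of_mul_eq_one hc1
  refine ⟨c, ⟨⟨c⁻¹ • U, ?_⟩, ?_⟩, ?_⟩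
  · rw [Matrix.mem_unitaryGroup_iff', star_smul, smul_mul_smul_comm,
      Matrix.mem_unitaryGroup_iff'.1 hU, star_inv₀, ← mul_inv, hc1, inv_one, one_smul]
  · change (c⁻¹ • U).det = 1
    rw [Matrix.det_smul, Fintype.card_fin, ← hc, inv_pow, inv_mul_cancel₀ (pow_ne_zero _ hc0)]
  · simp [smul_smul, hc0]

/-- A homogeneous polynomial function vanishing on the special unitary group vanishes. -/
theorem IsPolyFun.eq_zero_of_SUN (hN : 1 ≤ N) {f : Matrix (Fin N) (Fin N) ℂ → ℂ} (hf : IsPolyFun f)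
    {d : ℕ} (hd : ∀ c A, f (c • A) = c ^ d * f A)
    (h : ∀ V : SUN N, f ((V : UN N) : Matrix (Fin N) (Fin N) ℂ) = 0)
    (A : Matrix (Fin N) (Fin N) ℂ) : f A = 0 :=
  hf.eq_zero_of_unitary hd (fun U hU => by
    obtain ⟨c, V, rfl⟩ := exists_smul_mem_SUN hN hU
    rw [hd, h, mul_zero]) A

end PolynomialFunctions

section SpecialUnitary

variable {N : ℕ}

instance (N : ℕ) : BorelSpace (SUN N) := ⟨rfl⟩

/-- The inclusion of the special unitary group into matrices. -/
def SUN.toMatrix (N : ℕ) : SUN N →* Matrix (Fin N) (Fin N) ℂ :=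
  (Matrix.unitaryGroup (Fin N) ℂ).subtype.comp (SUN N).subtype

theorem SUN.toMatrix_inv (V : SUN N) : SUN.toMatrix N V⁻¹ = star (SUN.toMatrix N V) := rfl

theorem SUN.det_toMatrix (V : SUN N) : (SUN.toMatrix N V).det = 1 := V.2

theorem SUN.continuous_toMatrix : Continuous (SUN.toMatrix N) :=
  continuous_subtype_val.comp continuous_subtype_val

theorem SUN.range_toMatrix : Set.range (SUN.toMatrix N) =
    {A | star A * A = 1 ∧ A.det = 1} := by
  ext A
  constructor
  · rintro ⟨V, rfl⟩
    exact ⟨Matrix.mem_unitaryGroup_iff'.1 V.1.2, V.2⟩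
  · rintro ⟨h1, h2⟩
    exact ⟨⟨⟨A, Matrix.mem_unitaryGroup_iff'.2 h1⟩, h2⟩, rfl⟩

open scoped Matrix.Norms.Elementwise in
instance (N : ℕ) : CompactSpace (SUN N) := by
  have hemb : Topology.IsInducing (SUN.toMatrix N) :=
    Topology.IsInducing.subtypeVal.comp Topology.IsInducing.subtypeVal
  rw [← isCompact_univ_iff, hemb.isCompact_iff, Set.image_univ, SUN.range_toMatrix]
  refine Metric.isCompact_of_isClosed_isBounded ?_ ?_
  · exact (isClosed_eq (by fun_prop) continuous_const).inter
      (isClosed_eq (by fun_prop) continuous_const)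
  · refine (Metric.isBounded_closedBall (x := (0 : Matrix (Fin N) (Fin N) ℂ)) (r := 1)).subset ?_
    rintro A ⟨h1, -⟩
    rw [mem_closedBall_zero_iff]
    exact entrywise_sup_norm_bound_of_unitary (Matrix.mem_unitaryGroup_iff'.2 h1)

variable (μ : Measure (SUN N)) [μ.IsHaarMeasure] [IsProbabilityMeasure μ]

instance : μ.IsMulRightInvariant where
  map_mul_right_eq_self g := by
    have : IsProbabilityMeasure (μ.map (· * g)) :=
      Measure.isProbabilityMeasure_map (by fun_prop)
    exact Measure.isHaarMeasure_eq_of_isProbabilityMeasure _ _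

instance : μ.IsInvInvariant where
  inv_eq_self := by
    have : IsProbabilityMeasure μ.inv :=
      Measure.isProbabilityMeasure_map (by fun_prop)
    have : μ.inv.IsHaarMeasure := Measure.isHaarMeasure_of_isCompact_nonempty_interior _ Set.univ
      isCompact_univ (by simp) (by simp) (by simp)
    exact Measure.isHaarMeasure_eq_of_isProbabilityMeasure _ _

/-- The restriction of `polyRep` to the special unitary group. -/
def suRep (N d : ℕ) : SUN N →* Matrix (ExpMat N d) (ExpMat N d) ℂ :=
  (polyRep N d).comp (SUN.toMatrix N)

theorem suRep_apply (d : ℕ) (V : SUN N) : suRep N d V = polyRep N d (SUN.toMatrix N V) := rfl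

theorem continuous_suRep (d : ℕ) : Continuous (suRep N d) :=
  (continuous_polyRep d).comp SUN.continuous_toMatrix

/-- The unitary trick for matrix coefficients of `polyRep`. -/
theorem trace_mul_polyRep_eq_zero (hN : 1 ≤ N) {d : ℕ} {C : Matrix (ExpMat N d) (ExpMat N d) ℂ}
    (h : ∀ V, (C * suRep N d V).trace = 0) (A : Matrix (Fin N) (Fin N) ℂ) :
    (C * polyRep N d A).trace = 0 :=
  (isPolyFun_trace_polyRep C).eq_zero_of_SUN hN (d := d)
    (fun c A => by rw [polyRep_smul, mul_smul_comm, Matrix.trace_smul, smul_eq_mul]) h A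

theorem commute_suRep_iff (hN : 1 ≤ N) {d : ℕ} (T : Matrix (ExpMat N d) (ExpMat N d) ℂ) :
    (∀ V, suRep N d V * T = T * suRep N d V) ↔
      ∀ A, polyRep N d A * T = T * polyRep N d A := by
  refine ⟨fun h A => ?_, fun h V => h _⟩
  refine Matrix.ext_iff_trace_mul_left.2 fun C => ?_
  have h1 : ∀ R : Matrix (ExpMat N d) (ExpMat N d) ℂ,
      ((T * C - C * T) * R).trace = (C * (R * T)).trace - (C * (T * R)).trace := fun R => by
    rw [sub_mul, Matrix.trace_sub, mul_assoc, Matrix.trace_mul_comm T]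
    simp only [mul_assoc]
  have h2 := trace_mul_polyRep_eq_zero hN (C := T * C - C * T) (fun V => by
    rw [h1, h, sub_self]) A
  rw [h1] at h2
  exact sub_eq_zero.1 h2

theorem integral_trace_rowProj (hN : 1 ≤ N) (d : ℕ) (k l : Fin N → ℕ) :
    ∫ V, (rowProj d k * suRep N d V).trace * (rowProj d l * suRep N d V⁻¹).trace ∂μ =
      numExpMat d k l := by
  have h1 := (isProj_averageProj (μ := μ) (continuous_suRep d) (rowProj_mul_self d k)
    (rowProj_mul_self d l) (fun V => polyRep_mul_rowProj d k _)
    (fun V => polyRep_mul_rowProj d l _)).trace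
  rw [trace_averageProj, finrank_commutantBlock d k l _ (commute_suRep_iff hN)] at h1
  exact h1

end SpecialUnitary

section CompleteHomogeneous

variable {N : ℕ} {R : Type*} [CommRing R]

/-- The generating series of the complete homogeneous symmetric functions. -/
def hSeries (x : Fin N → R) : PowerSeries R := ∏ i, PowerSeries.mk fun n => x i ^ n

/-- The complete homogeneous symmetric functions. -/
def hSum (x : Fin N → R) (n : ℕ) : R := PowerSeries.coeff n (hSeries x)

theorem hSum_eq_sum (x : Fin N → R) (n : ℕ) :
    hSum x n = ∑ a ∈ Finset.piAntidiag Finset.univ n, ∏ i, x i ^ a i := by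
  rw [hSum, hSeries, PowerSeries.coeff_prod]
  refine Finset.sum_nbij' (fun a => ⇑a) (fun a => Finsupp.equivFunOnFinite.symm a) ?_ ?_ ?_ ?_ ?_
  · intro a ha
    simpa using ha
  · intro a ha
    simpa using ha
  · intro a _
    simp
  · intro a _
    simp
  · intro a _
    simp

theorem hSum_zero (x : Fin N → R) : hSum x 0 = 1 := by
  simp [hSum, hSeries, map_prod]

theorem derivative_geometric (x : R) : PowerSeries.derivative R (PowerSeries.mk fun n => x ^ n) =
    (PowerSeries.mk fun n => x ^ (n + 1)) * PowerSeries.mk fun n => x ^ n := by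
  ext n
  rw [PowerSeries.coeff_derivative, PowerSeries.coeff_mul, PowerSeries.coeff_mk]
  simp only [PowerSeries.coeff_mk]
  rw [Finset.sum_congr rfl fun p hp => show x ^ (p.1 + 1) * x ^ p.2 = x ^ (n + 1) by
    rw [← pow_add, ← Finset.HasAntidiagonal.mem_antidiagonal.1 hp]; congr 1; ring]
  simp [mul_comm]

theorem derivative_hSeries (x : Fin N → R) : PowerSeries.derivative R (hSeries x) =
    (PowerSeries.mk fun n => ∑ i, x i ^ (n + 1)) * hSeries x := by
  have h1 : (PowerSeries.mk fun n => ∑ i, x i ^ (n + 1)) =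
      ∑ i, PowerSeries.mk fun n => x i ^ (n + 1) := by
    ext n
    simp
  rw [hSeries, h1]
  induction (Finset.univ : Finset (Fin N)) using Finset.induction_on with
  | empty => simp
  | insert i s hi ih =>
    rw [Finset.prod_insert hi, Finset.sum_insert hi, Derivation.leibniz, ih, derivative_geometric,
      smul_eq_mul, smul_eq_mul]
    ring

theorem newton_hSum (x : Fin N → R) (n : ℕ) : ((n : R) + 1) * hSum x (n + 1) =
    ∑ m ∈ Finset.range (n + 1), (∑ i, x i ^ (m + 1)) * hSum x (n - m) := by
  have := congrArg (PowerSeries.coeff n) (derivative_hSeries x)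
  rw [PowerSeries.coeff_derivative, PowerSeries.coeff_mul,
    Finset.Nat.sum_antidiagonal_eq_sum_range_succ_mk] at this
  simpa [hSum, mul_comm] using this

theorem hMat_diagonal (x : Fin N → ℂ) (n : ℕ) : hMat (Matrix.diagonal x) n = hSum x n := by
  induction n using Nat.strong_induction_on with
  | _ n ih =>
    cases n with
    | zero => rw [hMat, hSum_zero]
    | succ n =>
      have h0 : (n : ℂ) + 1 ≠ 0 := Nat.cast_add_one_ne_zero n
      rw [hMat, inv_mul_eq_iff_eq_mul₀ h0, newton_hSum]
      refine Finset.sum_congr rfl fun m _ => ?_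
      rw [ih (n - m) (by omega), Matrix.diagonal_pow, Matrix.trace_diagonal]
      simp

end CompleteHomogeneous

section ClassFunctions

variable {N : ℕ}

theorem trace_mul_pow_comm {n : Type*} [Fintype n] [DecidableEq n] (A B : Matrix n n ℂ) (m : ℕ) :
    ((A * B) ^ (m + 1)).trace = ((B * A) ^ (m + 1)).trace := by
  have h : A * (B * A) ^ m = (A * B) ^ m * A :=
    SemiconjBy.pow_right (show SemiconjBy A (B * A) (A * B) from (mul_assoc _ _ _).symm) m
  rw [pow_succ, ← mul_assoc, ← h, Matrix.trace_mul_comm, ← mul_assoc, pow_succ']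

theorem hMat_mul_comm (A B : Matrix (Fin N) (Fin N) ℂ) (n : ℕ) :
    hMat (A * B) n = hMat (B * A) n := by
  induction n using Nat.strong_induction_on with
  | _ n ih =>
    cases n with
    | zero => rw [hMat, hMat]
    | succ n =>
      rw [hMat, hMat]
      congr 1
      refine Finset.sum_congr rfl fun m _ => ?_
      rw [ih (n - m) (by omega), trace_mul_pow_comm]

theorem hMatZ_mul_comm (A B : Matrix (Fin N) (Fin N) ℂ) (k : ℤ) :
    hMatZ (A * B) k = hMatZ (B * A) k := by
  rw [hMatZ, hMatZ, hMat_mul_comm]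

theorem schur_mul_comm (l : Fin N → ℕ) (A B : Matrix (Fin N) (Fin N) ℂ) :
    schur l (A * B) = schur l (B * A) := by
  simp only [schur, hMatZ_mul_comm A B]

theorem isPolyFun_hMat (n : ℕ) : IsPolyFun fun A : Matrix (Fin N) (Fin N) ℂ => hMat A n := by
  induction n using Nat.strong_induction_on with
  | _ n ih =>
    cases n with
    | zero =>
      simp only [hMat]
      exact isPolyFun_const 1
    | succ n =>
      simp only [hMat]
      exact (isPolyFun_const _).mul (IsPolyFun.sum _ fun m _ =>
        (isPolyFun_pow_trace _).mul (ih (n - m) (by omega)))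

theorem isPolyFun_hMatZ (k : ℤ) : IsPolyFun fun A : Matrix (Fin N) (Fin N) ℂ => hMatZ A k := by
  simp only [hMatZ]
  split_ifs
  · exact isPolyFun_const 0
  · exact isPolyFun_hMat _

theorem isPolyFun_schur (l : Fin N → ℕ) : IsPolyFun (schur l) :=
  IsPolyFun.det fun _ _ => isPolyFun_hMatZ _

/-- Polynomial class functions are determined by their values on diagonal matrices. -/
theorem IsPolyFun.eq_of_diagonal {f g : Matrix (Fin N) (Fin N) ℂ → ℂ} (hf : IsPolyFun f)
    (hg : IsPolyFun g) (hf' : ∀ A B, f (A * B) = f (B * A)) (hg' : ∀ A B, g (A * B) = g (B * A))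
    (h : ∀ x : Fin N → ℂ, f (Matrix.diagonal x) = g (Matrix.diagonal x)) : f = g := by
  funext A
  refine sub_eq_zero.1 ((hf.sub hg).eq_zero_of_isHermitian (fun H hH => ?_) A)
  have h1 := hH.spectral_theorem
  rw [Unitary.conjStarAlgAut_apply] at h1
  have h2 : ∀ {f : Matrix (Fin N) (Fin N) ℂ → ℂ}, (∀ A B, f (A * B) = f (B * A)) →
      f H = f (Matrix.diagonal (RCLike.ofReal ∘ hH.eigenvalues)) := by
    intro f hf
    conv_lhs => rw [h1]
    rw [hf, ← mul_assoc, Unitary.coe_star_mul_self, one_mul]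
  rw [h2 hf', h2 hg', h, sub_self]

end ClassFunctions

section TraceFormula

variable {N : ℕ} {R : Type*} [CommRing R]

theorem sum_expMat_rowSum {d : ℕ} {k : Fin N → ℕ} (hk : ∑ i, k i = d) (x : Fin N → R) :
    ∑ M : ExpMat N d, (if rowSum M.1 = k then ∏ j, x j ^ colSum M.1 j else 0) =
      ∏ i, hSum x (k i) := by
  simp only [hSum_eq_sum]
  rw [Finset.prod_univ_sum, Finset.sum_coe_sort (Finset.piAntidiag Finset.univ d)
    (fun M => if rowSum M = k then ∏ j, x j ^ colSum M j else 0), ← Finset.sum_filter]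
  refine Finset.sum_nbij' (fun M i j => M (i, j)) (fun F p => F p.1 p.2) ?_ ?_ ?_ ?_ ?_
  · intro M hM
    simp only [Finset.mem_filter] at hM
    simp [← hM.2, rowSum]
  · intro F hF
    have h1 : ∀ i, ∑ j, F i j = k i := by simpa using hF
    simp only [Finset.mem_filter, mem_expMat, Fintype.sum_prod_type, h1, hk, true_and]
    funext i
    exact h1 i
  · intro M _
    rfl
  · intro F _
    rfl
  · intro M _
    rw [Finset.prod_comm]
    refine Finset.prod_congr rfl fun j _ => ?_
    exact (Finset.prod_pow_eq_pow_sum Finset.univ (fun i => M (i, j)) (x j)).symm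

/-- Complete homogeneous symmetric functions indexed by integers. -/
def hSumZ (x : Fin N → R) (k : ℤ) : R := if k < 0 then 0 else hSum x k.toNat

theorem sum_expMat_rowSum_int {d : ℕ} {k : Fin N → ℤ} (hk : ∑ i, k i = d) (x : Fin N → R) :
    ∑ M : ExpMat N d, (if ∀ i, (rowSum M.1 i : ℤ) = k i then ∏ j, x j ^ colSum M.1 j else 0) =
      ∏ i, hSumZ x (k i) := by
  by_cases h : ∀ i, 0 ≤ k i
  · lift k to Fin N → ℕ using h
    have h1 : ∀ i, hSumZ x (k i : ℤ) = hSum x (k i) := fun i => by simp [hSumZ]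
    simp only [h1, Nat.cast_inj]
    have hk' : ∑ i, k i = d := by
      have h2 : ((∑ i, k i : ℕ) : ℤ) = d := by
        rw [Nat.cast_sum]
        exact hk
      exact_mod_cast h2
    rw [← sum_expMat_rowSum hk' x]
    simp only [funext_iff]
  · push Not at h
    obtain ⟨i, hi⟩ := h
    rw [Finset.prod_eq_zero (Finset.mem_univ i) (by simp [hSumZ, hi])]
    refine Finset.sum_eq_zero fun M _ => if_neg fun h => ?_
    have := h i
    omega

theorem hMatZ_diagonal (x : Fin N → ℂ) (k : ℤ) : hMatZ (Matrix.diagonal x) k = hSumZ x k := by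
  rw [hMatZ, hSumZ, hMat_diagonal]

/-- The projection onto polynomials with row degrees `k`, which is zero if some `k i` is
negative. -/
def intRowProj (d : ℕ) (k : Fin N → ℤ) : Matrix (ExpMat N d) (ExpMat N d) ℂ :=
  Matrix.diagonal fun M => if ∀ i, (rowSum M.1 i : ℤ) = k i then 1 else 0

theorem intRowProj_natCast (d : ℕ) (k : Fin N → ℕ) :
    intRowProj d (fun i => (k i : ℤ)) = rowProj d k := by
  simp only [intRowProj, rowProj, Nat.cast_inj, funext_iff]

theorem intRowProj_eq_zero (d : ℕ) {k : Fin N → ℤ} (h : ∃ i, k i < 0) : intRowProj d k = 0 := by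
  obtain ⟨i, hi⟩ := h
  rw [intRowProj, Matrix.diagonal_eq_zero]
  funext M
  refine if_neg fun h => ?_
  have := h i
  omega

theorem polyRep_mul_intRowProj (d : ℕ) (k : Fin N → ℤ) (A : Matrix (Fin N) (Fin N) ℂ) :
    polyRep N d A * intRowProj d k = intRowProj d k * polyRep N d A := by
  by_cases h : ∀ i, 0 ≤ k i
  · lift k to Fin N → ℕ using h
    rw [intRowProj_natCast, polyRep_mul_rowProj]
  · push Not at h
    rw [intRowProj_eq_zero d h, zero_mul, mul_zero]

theorem trace_intRowProj_mul_polyRep {d : ℕ} {k : Fin N → ℤ} (hk : ∑ i, k i = d)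
    (A : Matrix (Fin N) (Fin N) ℂ) :
    (intRowProj d k * polyRep N d A).trace = ∏ i, hMatZ A (k i) := by
  refine congrFun (IsPolyFun.eq_of_diagonal (isPolyFun_trace_polyRep _)
    (IsPolyFun.prod _ fun i _ => isPolyFun_hMatZ (k i)) (fun A B => ?_) (fun A B => ?_)
    fun x => ?_) A
  · rw [map_mul, map_mul, ← mul_assoc, ← polyRep_mul_intRowProj, mul_assoc, Matrix.trace_mul_comm,
      mul_assoc]
  · simp only [hMatZ_mul_comm A B]
  · simp only [hMatZ_diagonal]
    rw [← sum_expMat_rowSum_int hk, polyRep_diagonal, intRowProj, Matrix.diagonal_mul_diagonal,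
      Matrix.trace_diagonal]
    simp

/-- The index vector of the term `w` of the Jacobi-Trudi determinant. -/
def jtIndex (l : Fin N → ℕ) (w : Equiv.Perm (Fin N)) (i : Fin N) : ℤ := (l i : ℤ) - i + (w i : ℕ)

theorem sum_jtIndex (l : Fin N → ℕ) (w : Equiv.Perm (Fin N)) :
    ∑ i, jtIndex l w i = ((∑ i, l i : ℕ) : ℤ) := by
  simp only [jtIndex, Finset.sum_add_distrib, Finset.sum_sub_distrib]
  rw [Equiv.sum_comp w (fun i => ((i : ℕ) : ℤ))]
  simp

theorem schur_eq_sum (l : Fin N → ℕ) (A : Matrix (Fin N) (Fin N) ℂ) :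
    schur l A = ∑ w : Equiv.Perm (Fin N), ((Equiv.Perm.sign w : ℤ) : ℂ) *
      ∏ i, hMatZ A (jtIndex l w i) := by
  rw [schur, ← Matrix.det_transpose, Matrix.det_apply']
  rfl

/-- The virtual projection whose character is the Schur polynomial. -/
def schurProj (d : ℕ) (l : Fin N → ℕ) : Matrix (ExpMat N d) (ExpMat N d) ℂ :=
  ∑ w : Equiv.Perm (Fin N), ((Equiv.Perm.sign w : ℤ) : ℂ) • intRowProj d (jtIndex l w)

theorem trace_schurProj_mul_polyRep {d : ℕ} {l : Fin N → ℕ} (hl : ∑ i, l i = d)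
    (A : Matrix (Fin N) (Fin N) ℂ) : (schurProj d l * polyRep N d A).trace = schur l A := by
  rw [schurProj, Finset.sum_mul, Matrix.trace_sum, schur_eq_sum]
  refine Finset.sum_congr rfl fun w _ => ?_
  rw [smul_mul_assoc, Matrix.trace_smul, smul_eq_mul, trace_intRowProj_mul_polyRep]
  rw [sum_jtIndex, hl]

end TraceFormula

section Bialternant

variable {N : ℕ} {R : Type*} [CommRing R]

theorem geometric_mul_one_sub (x : R) :
    (PowerSeries.mk fun n => x ^ n) * (1 - PowerSeries.C x * PowerSeries.X) = 1 := by
  ext n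
  rw [mul_sub, mul_one, mul_comm (PowerSeries.C x), ← mul_assoc, map_sub, PowerSeries.coeff_mul_C]
  cases n with
  | zero => simp
  | succ n => simp [PowerSeries.coeff_succ_mul_X, pow_succ, PowerSeries.coeff_one]

/-- The generating polynomial of the signed elementary symmetric functions of the variables other
than `x k`. -/
def erasePoly (x : Fin N → R) (k : Fin N) : Polynomial R :=
  ∏ m ∈ Finset.univ.erase k, (1 - Polynomial.C (x m) * Polynomial.X)

theorem coeff_erasePoly_eq_zero (x : Fin N → R) (k : Fin N) {r : ℕ} (hr : N ≤ r) :
    (erasePoly x k).coeff r = 0 := by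
  refine Polynomial.coeff_eq_zero_of_natDegree_lt (lt_of_lt_of_le ?_ hr)
  have hN : 0 < N := k.pos
  refine lt_of_le_of_lt (Polynomial.natDegree_prod_le _ _) (lt_of_le_of_lt
    (Finset.sum_le_card_nsmul _ _ 1 fun m _ => ?_) ?_)
  · refine (Polynomial.natDegree_sub_le _ _).trans ?_
    simpa using Polynomial.natDegree_C_mul_le (x m) Polynomial.X |>.trans Polynomial.natDegree_X_le
  · simp [Finset.card_erase_of_mem]
    omega

theorem hSeries_mul_erasePoly (x : Fin N → R) (k : Fin N) :
    hSeries x * (erasePoly x k : PowerSeries R) = PowerSeries.mk fun n => x k ^ n := by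
  have h : (erasePoly x k : PowerSeries R) =
      ∏ m ∈ Finset.univ.erase k, (1 - PowerSeries.C (x m) * PowerSeries.X) := by
    rw [erasePoly, ← Polynomial.coeToPowerSeries.ringHom_apply, map_prod]
    simp
  rw [h, hSeries, ← Finset.mul_prod_erase _ _ (Finset.mem_univ k), mul_assoc,
    ← Finset.prod_mul_distrib]
  simp only [geometric_mul_one_sub, Finset.prod_const_one, mul_one]

theorem sum_hSumZ_mul_coeff_erasePoly (x : Fin N → R) (k : Fin N) (n : ℕ) :
    ∑ j : Fin N, hSumZ x ((n : ℤ) - (j.rev : ℕ)) * (erasePoly x k).coeff (j.rev : ℕ) =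
      x k ^ n := by
  set g : ℕ → R := fun j => hSumZ x ((n : ℤ) - j) * (erasePoly x k).coeff j with hg
  have h := congrArg (PowerSeries.coeff n) (hSeries_mul_erasePoly x k)
  rw [PowerSeries.coeff_mk, mul_comm, PowerSeries.coeff_mul,
    Finset.Nat.sum_antidiagonal_eq_sum_range_succ_mk] at h
  have h1 : ∑ j ∈ Finset.range (n + 1), g j = x k ^ n := by
    rw [← h]
    refine Finset.sum_congr rfl fun j hj => ?_
    have hj' := Finset.mem_range.1 hj
    rw [hg, mul_comm]
    simp only [Polynomial.coeff_coe, hSumZ, if_neg (show ¬ (n : ℤ) - j < 0 by omega), hSum,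
      show ((n : ℤ) - j).toNat = n - j by omega]
  have h2 : ∑ j ∈ Finset.range (n + 1), g j = ∑ j ∈ Finset.range (N + n + 1), g j := by
    refine Finset.sum_subset (Finset.range_mono (by omega)) fun j _ hj => ?_
    have hj' : ¬ j < n + 1 := fun h => hj (Finset.mem_range.2 h)
    simp only [hg, hSumZ]
    rw [if_pos (by omega), zero_mul]
  have h3 : ∑ j ∈ Finset.range N, g j = ∑ j ∈ Finset.range (N + n + 1), g j := by
    refine Finset.sum_subset (Finset.range_mono (by omega)) fun j _ hj => ?_
    have hj' : ¬ j < N := fun h => hj (Finset.mem_range.2 h)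
    simp only [hg]
    rw [coeff_erasePoly_eq_zero x k (by omega), mul_zero]
  rw [← h1, h2, ← h3, ← Fin.sum_univ_eq_sum_range]
  exact Equiv.sum_comp Fin.revPerm fun j : Fin N => g j

/-- The alternant with exponents `a`. -/
def alternant (x : Fin N → R) (a : Fin N → ℕ) : R := (Matrix.of fun i k => x k ^ a i).det

/-- The Jacobi-Trudi determinant. -/
def jacobiTrudi (x : Fin N → R) (l : Fin N → ℕ) : R :=
  (Matrix.of fun i j : Fin N => hSumZ x ((l i : ℤ) - (i : ℤ) + (j : ℤ))).det

theorem jacobiTrudi_zero (x : Fin N → R) : jacobiTrudi x 0 = 1 := by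
  rw [jacobiTrudi, Matrix.det_of_isUpperTriangular]
  · refine Finset.prod_eq_one fun i _ => ?_
    simp [hSumZ, hSum_zero]
  · intro i j hij
    simp only [id_eq] at hij
    have : (j : ℕ) < i := hij
    simp only [Matrix.of_apply, Pi.zero_apply, hSumZ]
    rw [if_pos (by omega)]

theorem jacobiTrudi_mul_det_erasePoly (x : Fin N → R) (l : Fin N → ℕ) :
    jacobiTrudi x l * (Matrix.of fun j k : Fin N => (erasePoly x k).coeff (j.rev : ℕ)).det =
      alternant x fun i => l i + (i.rev : ℕ) := by
  rw [jacobiTrudi, alternant, ← Matrix.det_mul]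
  congr 1
  ext i k
  rw [Matrix.mul_apply, Matrix.of_apply, ← sum_hSumZ_mul_coeff_erasePoly]
  refine Finset.sum_congr rfl fun j _ => ?_
  simp only [Matrix.of_apply]
  congr 2
  simp only [Fin.val_rev]
  have := i.2
  have := j.2
  push_cast [Nat.cast_sub (show (i : ℕ) + 1 ≤ N by omega),
    Nat.cast_sub (show (j : ℕ) + 1 ≤ N by omega)]
  ring

theorem jacobiTrudi_mul_alternant (x : Fin N → R) (l : Fin N → ℕ) :
    jacobiTrudi x l * alternant x (fun i => (i.rev : ℕ)) =
      alternant x fun i => l i + (i.rev : ℕ) := by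
  have h := jacobiTrudi_mul_det_erasePoly x (0 : Fin N → ℕ)
  simp only [jacobiTrudi_zero, one_mul, Pi.zero_apply, zero_add] at h
  rw [← h, jacobiTrudi_mul_det_erasePoly]

theorem alternant_add_const (x : Fin N → R) (a : Fin N → ℕ) (q : ℕ) :
    alternant x (fun i => a i + q) = (∏ k, x k) ^ q * alternant x a := by
  rw [alternant, alternant, ← Finset.prod_pow, ← Matrix.det_mul_row]
  congr 1
  ext i k
  simp [pow_add, mul_comm]

theorem jacobiTrudi_map {S : Type*} [CommRing S] (φ : R →+* S) (x : Fin N → R) (l : Fin N → ℕ) :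
    φ (jacobiTrudi x l) = jacobiTrudi (fun i => φ (x i)) l := by
  have h : ∀ k, φ (hSumZ x k) = hSumZ (fun i => φ (x i)) k := by
    intro k
    simp only [hSumZ, hSum_eq_sum]
    split_ifs <;> simp
  rw [jacobiTrudi, RingHom.map_det]
  congr 1
  ext i j
  simp [h]

theorem alternant_X_ne_zero :
    alternant (fun i : Fin N => (MvPolynomial.X i : MvPolynomial (Fin N) ℂ))
      (fun i => (i.rev : ℕ)) ≠ 0 := by
  have h : alternant (fun i : Fin N => (MvPolynomial.X i : MvPolynomial (Fin N) ℂ))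
      (fun i => (i.rev : ℕ)) = Equiv.Perm.sign (Fin.revPerm : Equiv.Perm (Fin N)) *
        (Matrix.vandermonde fun i : Fin N => (MvPolynomial.X i : MvPolynomial (Fin N) ℂ)).det := by
    rw [← Matrix.det_transpose (Matrix.vandermonde _), ← Matrix.det_permute]
    rfl
  rw [h]
  refine mul_ne_zero ?_ (Matrix.det_vandermonde_ne_zero_iff.2 (MvPolynomial.X_injective))
  exact_mod_cast (Int.cast_ne_zero (α := MvPolynomial (Fin N) ℂ)).2 (Units.ne_zero _)

theorem jacobiTrudi_X_add_const (l : Fin N → ℕ) (q : ℕ) :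
    jacobiTrudi (fun i : Fin N => (MvPolynomial.X i : MvPolynomial (Fin N) ℂ)) (fun i => l i + q) =
      (∏ i, MvPolynomial.X i) ^ q *
        jacobiTrudi (fun i : Fin N => (MvPolynomial.X i : MvPolynomial (Fin N) ℂ)) l := by
  refine mul_right_cancel₀ alternant_X_ne_zero ?_
  rw [jacobiTrudi_mul_alternant, mul_assoc, jacobiTrudi_mul_alternant, ← alternant_add_const]
  simp only [add_right_comm]

theorem jacobiTrudi_add_const (x : Fin N → ℂ) (l : Fin N → ℕ) (q : ℕ) :
    jacobiTrudi x (fun i => l i + q) = (∏ i, x i) ^ q * jacobiTrudi x l := by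
  have h := congrArg (MvPolynomial.aeval x).toRingHom (jacobiTrudi_X_add_const l q)
  rw [map_mul, jacobiTrudi_map, jacobiTrudi_map] at h
  simpa using h

theorem schur_diagonal (l : Fin N → ℕ) (x : Fin N → ℂ) :
    schur l (Matrix.diagonal x) = jacobiTrudi x l := by
  simp only [schur, jacobiTrudi, hMatZ_diagonal]

theorem schur_add_const (l : Fin N → ℕ) (q : ℕ) (A : Matrix (Fin N) (Fin N) ℂ) :
    schur (fun i => l i + q) A = A.det ^ q * schur l A := by
  refine congrFun (IsPolyFun.eq_of_diagonal (isPolyFun_schur _)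
    ((isPolyFun_det.pow q).mul (isPolyFun_schur l)) (schur_mul_comm _) (fun A B => ?_)
    fun x => ?_) A
  · rw [schur_mul_comm, Matrix.det_mul_comm]
  · rw [schur_diagonal, schur_diagonal, Matrix.det_diagonal, jacobiTrudi_add_const]

end Bialternant

section AlternantCoefficients

variable {N : ℕ}

theorem alternant_eq_sum {R : Type*} [CommRing R] (x : Fin N → R) (a : Fin N → ℕ) :
    alternant x a = ∑ w : Equiv.Perm (Fin N), ((Equiv.Perm.sign w : ℤ) : R) *
      ∏ i, x i ^ a (w i) := by
  rw [alternant, Matrix.det_apply']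
  rfl

theorem jacobiTrudi_eq_sum {R : Type*} [CommRing R] (x : Fin N → R) (l : Fin N → ℕ) :
    jacobiTrudi x l = ∑ w : Equiv.Perm (Fin N), ((Equiv.Perm.sign w : ℤ) : R) *
      ∏ i, hSumZ x (jtIndex l w i) := by
  rw [jacobiTrudi, ← Matrix.det_transpose, Matrix.det_apply']
  rfl

theorem coeff_prod_X_pow (a b : Fin N → ℕ) :
    MvPolynomial.coeff (Finsupp.equivFunOnFinite.symm b)
      (∏ j, (MvPolynomial.X j : MvPolynomial (Fin N) ℂ) ^ a j) = if a = b then 1 else 0 := by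
  have h : ∏ j, (MvPolynomial.X j : MvPolynomial (Fin N) ℂ) ^ a j =
      MvPolynomial.monomial (Finsupp.equivFunOnFinite.symm a) 1 := by
    rw [MvPolynomial.monomial_eq, Finsupp.prod_fintype _ _ (by simp)]
    simp
  rw [h, MvPolynomial.coeff_monomial]
  simp only [EmbeddingLike.apply_eq_iff_eq]

theorem strictMono_perm_eq_one {w : Equiv.Perm (Fin N)} (hw : StrictMono w) : w = 1 := by
  exact Equiv.coe_fn_injective ((StrictMono.range_inj hw strictMono_id).1
    (by simp [w.surjective.range_eq]))

theorem coeff_intCast_mul (b : Fin N →₀ ℕ) (n : ℤ) (p : MvPolynomial (Fin N) ℂ) :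
    MvPolynomial.coeff b ((n : MvPolynomial (Fin N) ℂ) * p) = n * MvPolynomial.coeff b p := by
  rw [← map_intCast (MvPolynomial.C : ℂ →+* MvPolynomial (Fin N) ℂ), MvPolynomial.coeff_C_mul]

theorem coeff_alternant_X {a b : Fin N → ℕ} (ha : StrictAnti a) (hb : StrictAnti b) :
    MvPolynomial.coeff (Finsupp.equivFunOnFinite.symm b)
      (alternant (fun i : Fin N => (MvPolynomial.X i : MvPolynomial (Fin N) ℂ)) a) =
        if a = b then 1 else 0 := by
  rw [alternant_eq_sum, MvPolynomial.coeff_sum, Finset.sum_eq_single 1]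
  · rw [coeff_intCast_mul]
    simp only [Equiv.Perm.coe_one, id_eq]
    rw [coeff_prod_X_pow]
    simp
  · intro w _ hw
    rw [coeff_intCast_mul, coeff_prod_X_pow (fun i => a (w i)), if_neg, mul_zero]
    intro h
    refine hw (strictMono_perm_eq_one fun i j hij => ?_)
    have h1 := hb hij
    rw [← h] at h1
    exact ha.lt_iff_gt.1 h1
  · simp

theorem coeff_prod_X_pow_mul_alternant (a l : Fin N → ℕ) :
    MvPolynomial.coeff (Finsupp.equivFunOnFinite.symm fun i => l i + (i.rev : ℕ))
      ((∏ j, (MvPolynomial.X j : MvPolynomial (Fin N) ℂ) ^ a j) *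
        alternant (fun i : Fin N => (MvPolynomial.X i : MvPolynomial (Fin N) ℂ))
          fun i => (i.rev : ℕ)) =
      ∑ w : Equiv.Perm (Fin N), ((Equiv.Perm.sign w : ℤ) : ℂ) *
        if ∀ i, (a i : ℤ) = jtIndex l w i then 1 else 0 := by
  rw [alternant_eq_sum, Finset.mul_sum, MvPolynomial.coeff_sum]
  refine Finset.sum_congr rfl fun w _ => ?_
  rw [mul_left_comm, coeff_intCast_mul, ← Finset.prod_mul_distrib]
  simp only [← pow_add]
  rw [coeff_prod_X_pow (fun i => a i + ((w i).rev : ℕ))]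
  congr 2
  rw [funext_iff, eq_iff_iff]
  refine forall_congr' fun i => ?_
  have := (w i).2
  have := i.2
  simp only [jtIndex, Fin.val_rev]
  omega

theorem strictAnti_add_rev {l : Fin N → ℕ} (hl : Antitone l) :
    StrictAnti fun i : Fin N => l i + (i.rev : ℕ) := by
  intro i j hij
  have := hl hij.le
  have h2 : (i : ℕ) < j := hij
  have := j.2
  simp only [Fin.val_rev]
  omega

theorem sum_sign_mul_expMat {d : ℕ} {l m : Fin N → ℕ} (hl : Antitone l) (hm : Antitone m)
    (hmd : ∑ i, m i = d) :
    ∑ w' : Equiv.Perm (Fin N), ((Equiv.Perm.sign w' : ℤ) : ℂ) * ∑ M : ExpMat N d,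
      (if ∀ i, (rowSum M.1 i : ℤ) = jtIndex m w' i then
        ∑ w : Equiv.Perm (Fin N), ((Equiv.Perm.sign w : ℤ) : ℂ) *
          (if ∀ i, (colSum M.1 i : ℤ) = jtIndex l w i then 1 else 0) else 0) =
      if l = m then 1 else 0 := by
  have h1 : (if l = m then (1 : ℂ) else 0) =
      if (fun i => m i + (i.rev : ℕ)) = (fun i => l i + (i.rev : ℕ)) then 1 else 0 := by
    refine if_congr ?_ rfl rfl
    simp only [funext_iff, add_left_inj]
    exact forall_congr' fun i => eq_comm
  rw [h1, ← coeff_alternant_X (strictAnti_add_rev hm) (strictAnti_add_rev hl),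
    ← jacobiTrudi_mul_alternant, jacobiTrudi_eq_sum, Finset.sum_mul, MvPolynomial.coeff_sum]
  refine Finset.sum_congr rfl fun w' _ => ?_
  have h2 : ∑ i, jtIndex m w' i = d := by rw [sum_jtIndex, hmd]
  rw [mul_assoc, coeff_intCast_mul, ← sum_expMat_rowSum_int h2, Finset.sum_mul,
    MvPolynomial.coeff_sum]
  refine congrArg (_ * ·) (Finset.sum_congr rfl fun M _ => ?_)
  rw [ite_mul, zero_mul, ← coeff_prod_X_pow_mul_alternant]
  split_ifs
  · rfl
  · rw [MvPolynomial.coeff_zero]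

end AlternantCoefficients

section Orthonormality

variable {N : ℕ} (μ : Measure (SUN N)) [μ.IsHaarMeasure] [IsProbabilityMeasure μ]

theorem integral_trace_intRowProj (hN : 1 ≤ N) (d : ℕ) (k l : Fin N → ℤ) :
    ∫ V, (intRowProj d k * suRep N d V).trace * (intRowProj d l * suRep N d V⁻¹).trace ∂μ =
      ∑ M : ExpMat N d, if ∀ i, (rowSum M.1 i : ℤ) = l i then
        (if ∀ i, (colSum M.1 i : ℤ) = k i then 1 else 0) else 0 := by
  by_cases hk : ∀ i, 0 ≤ k i
  · by_cases hl : ∀ i, 0 ≤ l i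
    · lift k to Fin N → ℕ using hk
      lift l to Fin N → ℕ using hl
      simp only [intRowProj_natCast, Nat.cast_inj, ← funext_iff, ← ite_and]
      rw [integral_trace_rowProj μ hN, numExpMat, Fintype.card_subtype, Finset.sum_boole]
    · push Not at hl
      obtain ⟨i, hi⟩ := hl
      rw [intRowProj_eq_zero d ⟨i, hi⟩, Finset.sum_eq_zero fun M _ => if_neg fun h => ?_]
      · simp
      · have := h i
        omega
  · push Not at hk
    obtain ⟨i, hi⟩ := hk
    rw [intRowProj_eq_zero d ⟨i, hi⟩]
    symm
    simp only [zero_mul, Matrix.trace_zero, integral_zero]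
    refine Finset.sum_eq_zero fun M _ => ?_
    rw [← ite_and]
    refine if_neg fun h => ?_
    have := h.2 i
    omega

/-- The Schur polynomial as a function on the special unitary group. -/
def suSchur (l : Fin N → ℕ) (V : SUN N) : ℂ := schur l (SUN.toMatrix N V)

theorem suSchur_eq_trace {d : ℕ} {l : Fin N → ℕ} (hl : ∑ i, l i = d) (V : SUN N) :
    suSchur l V = (schurProj d l * suRep N d V).trace :=
  (trace_schurProj_mul_polyRep hl _).symm

theorem continuous_trace_suRep {d : ℕ} (C : Matrix (ExpMat N d) (ExpMat N d) ℂ) :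
    Continuous fun V => (C * suRep N d V).trace :=
  (continuous_const.matrix_mul (continuous_suRep d)).matrix_trace

theorem continuous_suSchur (l : Fin N → ℕ) : Continuous (suSchur l) := by
  have : suSchur l = fun V => (schurProj (∑ i, l i) l * suRep N (∑ i, l i) V).trace :=
    funext fun V => suSchur_eq_trace rfl V
  rw [this]
  exact continuous_trace_suRep _

theorem suSchur_mul_comm (l : Fin N → ℕ) (V W : SUN N) : suSchur l (V * W) = suSchur l (W * V) := by
  rw [suSchur, suSchur, map_mul, map_mul, schur_mul_comm]

/-- Schur polynomials of the same degree are orthonormal. -/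
theorem integral_suSchur_mul_inv (hN : 1 ≤ N) {l m : Fin N → ℕ} (hl : Antitone l) (hm : Antitone m)
    (h : ∑ i, l i = ∑ i, m i) :
    ∫ V, suSchur l V * suSchur m V⁻¹ ∂μ = if l = m then 1 else 0 := by
  set d := ∑ i, m i with hd
  have h_integrable : ∀ C D : Matrix (ExpMat N d) (ExpMat N d) ℂ,
      Integrable (fun V => (C * suRep N d V).trace * (D * suRep N d V⁻¹).trace) μ := fun C D =>
    integrable_of_continuous_of_compactSpace
      ((continuous_trace_suRep C).mul ((continuous_trace_suRep D).comp continuous_inv))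
  rw [← sum_sign_mul_expMat hl hm hd.symm]
  have h1 : ∀ V, suSchur l V * suSchur m V⁻¹ = ∑ w' : Equiv.Perm (Fin N),
      ∑ w : Equiv.Perm (Fin N), (((Equiv.Perm.sign w' : ℤ) : ℂ) * ((Equiv.Perm.sign w : ℤ) : ℂ)) *
      ((intRowProj d (jtIndex l w) * suRep N d V).trace *
        (intRowProj d (jtIndex m w') * suRep N d V⁻¹).trace) := fun V => by
    rw [suSchur_eq_trace h, suSchur_eq_trace hd.symm, schurProj, schurProj, Finset.sum_mul,
      Finset.sum_mul, Matrix.trace_sum, Matrix.trace_sum, Finset.sum_mul_sum, Finset.sum_comm]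
    refine Finset.sum_congr rfl fun w' _ => Finset.sum_congr rfl fun w _ => ?_
    rw [smul_mul_assoc, smul_mul_assoc, Matrix.trace_smul, Matrix.trace_smul, smul_eq_mul,
      smul_eq_mul]
    ring
  simp_rw [h1]
  rw [integral_finsetSum _ fun w' _ =>
    integrable_finsetSum _ fun w _ => (h_integrable _ _).const_mul _]
  refine Finset.sum_congr rfl fun w' _ => ?_
  rw [integral_finsetSum _ fun w _ => (h_integrable _ _).const_mul _, Finset.mul_sum]
  simp_rw [integral_const_mul, integral_trace_intRowProj μ hN, Finset.mul_sum]
  rw [Finset.sum_comm]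
  refine Finset.sum_congr rfl fun M _ => ?_
  split_ifs with hM
  · rw [Finset.mul_sum]
    exact Finset.sum_congr rfl fun w _ => mul_assoc _ _ _
  · simp

end Orthonormality

section Triangularity

variable {N : ℕ}

theorem sum_sq_lt_sum_sq_jtIndex {l : Fin N → ℕ} (hl : Antitone l) {w : Equiv.Perm (Fin N)}
    (hw : w ≠ 1) : ∑ i, (l i : ℤ) ^ 2 < ∑ i, jtIndex l w i ^ 2 := by
  set f : Fin N → ℤ := fun i => (l i : ℤ) - i with hf
  set g : Fin N → ℤ := fun i => (i : ℕ) with hg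
  have hf' : StrictAnti f := fun i j hij => by
    have := hl hij.le
    have h2 : (i : ℕ) < j := hij
    simp only [hf]
    omega
  have hg' : StrictMono g := fun i j hij => by
    have h2 : (i : ℕ) < j := hij
    simp only [hg]
    omega
  have h1 : ∑ i, f i * g i < ∑ i, f i * g (w i) := by
    refine (Antivary.sum_mul_lt_sum_mul_comp_perm_iff (hf'.antitone.antivary hg'.monotone)).2
      fun h => hw ?_
    have h2 : StrictMono w.symm := fun a b hab => by
      have h3 := h (i := w.symm a) (j := w.symm b) (by simpa using hg' hab)
      refine lt_of_le_of_ne (hf'.le_iff_ge.1 h3) fun h4 => hab.ne (w.symm.injective h4)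
    have := strictMono_perm_eq_one h2
    rw [← Equiv.symm_symm w, this]
    rfl
  have h2 : ∑ i, (l i : ℤ) ^ 2 = ∑ i, f i ^ 2 + 2 * ∑ i, f i * g i + ∑ i, g i ^ 2 := by
    rw [Finset.mul_sum, ← Finset.sum_add_distrib, ← Finset.sum_add_distrib]
    refine Finset.sum_congr rfl fun i _ => ?_
    simp only [hf, hg]
    ring
  have h3 : ∑ i, jtIndex l w i ^ 2 =
      ∑ i, f i ^ 2 + 2 * ∑ i, f i * g (w i) + ∑ i, g i ^ 2 := by
    rw [← Equiv.sum_comp w (fun i => g i ^ 2), Finset.mul_sum, ← Finset.sum_add_distrib,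
      ← Finset.sum_add_distrib]
    refine Finset.sum_congr rfl fun i _ => ?_
    simp only [hf, hg, jtIndex]
    ring
  rw [h2, h3]
  linarith

theorem exists_perm_antitone (k : Fin N → ℕ) : ∃ σ : Equiv.Perm (Fin N), Antitone (k ∘ σ) :=
  ⟨Fin.revPerm.trans (Tuple.sort k), fun _ _ hij =>
    Tuple.monotone_sort k (Fin.rev_le_rev.2 hij)⟩

theorem sum_sq_le_sq_sum (k : Fin N → ℕ) : ∑ i, k i ^ 2 ≤ (∑ i, k i) ^ 2 := by
  rw [sq, Finset.sum_mul]
  refine Finset.sum_le_sum fun i hi => ?_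
  rw [sq]
  exact Nat.mul_le_mul_left _ (Finset.single_le_sum (fun _ _ => Nat.zero_le _) hi)

/-- Partitions of `d` that come after `l` in the order by the sum of squares. -/
def laterPartitions (l : Fin N → ℕ) : Finset (Fin N → ℕ) :=
  (Finset.piAntidiag Finset.univ (∑ i, l i)).filter fun m =>
    Antitone m ∧ ∑ i, l i ^ 2 < ∑ i, m i ^ 2

theorem mem_laterPartitions {l m : Fin N → ℕ} : m ∈ laterPartitions l ↔
    ∑ i, m i = ∑ i, l i ∧ Antitone m ∧ ∑ i, l i ^ 2 < ∑ i, m i ^ 2 := by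
  simp [laterPartitions]

/-- Products of complete homogeneous functions are unitriangular in the Schur polynomials. -/
theorem prod_hMatZ_sub_schur_mem_span {l : Fin N → ℕ} (hl : Antitone l) :
    (fun A => ∏ i, hMatZ A (l i : ℤ)) - schur l ∈
      Submodule.span ℂ (schur '' (laterPartitions l : Set (Fin N → ℕ))) := by
  induction h : (∑ i, l i) ^ 2 - ∑ i, l i ^ 2 using Nat.strong_induction_on generalizing l with
  | _ n ih =>
    subst h
    have h1 : (fun A => ∏ i, hMatZ A (l i : ℤ)) - schur l =
        -∑ w ∈ (Finset.univ : Finset (Equiv.Perm (Fin N))).erase 1,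
          ((Equiv.Perm.sign w : ℤ) : ℂ) • fun A => ∏ i, hMatZ A (jtIndex l w i) := by
      funext A
      simp only [Pi.sub_apply, Pi.neg_apply, Finset.sum_apply, Pi.smul_apply, smul_eq_mul]
      rw [schur_eq_sum, ← Finset.add_sum_erase _ _ (Finset.mem_univ 1)]
      simp [jtIndex]
    rw [h1]
    refine Submodule.neg_mem _ (Submodule.sum_mem _ fun w hw => Submodule.smul_mem _ _ ?_)
    have hw1 : w ≠ 1 := Finset.ne_of_mem_erase hw
    have hlt := sum_sq_lt_sum_sq_jtIndex hl hw1
    have hsum := sum_jtIndex l w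
    by_cases hk : ∀ i, 0 ≤ jtIndex l w i
    · generalize jtIndex l w = k at hlt hsum hk
      lift k to Fin N → ℕ using hk
      obtain ⟨σ, hσ⟩ := exists_perm_antitone k
      have e1 : ∑ i, (k ∘ σ) i = ∑ i, l i := by
        rw [← Equiv.sum_comp σ] at hsum
        have h2 : ((∑ i, (k ∘ σ) i : ℕ) : ℤ) = (∑ i, l i : ℕ) := by
          rw [← hsum, Nat.cast_sum]
          rfl
        exact_mod_cast h2
      have e2 : ∑ i, l i ^ 2 < ∑ i, (k ∘ σ) i ^ 2 := by
        rw [← Equiv.sum_comp σ fun i => ((k i : ℕ) : ℤ) ^ 2] at hlt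
        have h2 : ((∑ i, l i ^ 2 : ℕ) : ℤ) < (∑ i, (k ∘ σ) i ^ 2 : ℕ) := by
          push_cast
          exact hlt
        exact_mod_cast h2
      have e3 : (fun A : Matrix (Fin N) (Fin N) ℂ => ∏ i, hMatZ A (k i : ℤ)) =
          ((fun A => ∏ i, hMatZ A ((k ∘ σ) i : ℤ)) - schur (k ∘ σ)) + schur (k ∘ σ) := by
        rw [sub_add_cancel]
        funext A
        exact (Equiv.prod_comp σ fun i => hMatZ A (k i : ℤ)).symm
      have e4 := sum_sq_le_sq_sum (k ∘ σ)
      rw [e3]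
      refine Submodule.add_mem _ (Submodule.span_mono (Set.image_mono fun m hm => ?_)
        (ih _ ?_ hσ rfl)) (Submodule.subset_span ⟨k ∘ σ, ?_, rfl⟩)
      · rw [Finset.mem_coe, mem_laterPartitions] at hm ⊢
        exact ⟨hm.1.trans e1, hm.2.1, e2.trans hm.2.2⟩
      · rw [e1] at e4 ⊢
        omega
      · rw [Finset.mem_coe, mem_laterPartitions]
        exact ⟨e1, hσ, e2⟩
    · push Not at hk
      obtain ⟨i, hi⟩ := hk
      have : (fun A : Matrix (Fin N) (Fin N) ℂ => ∏ i, hMatZ A (jtIndex l w i)) = 0 := by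
        funext A
        exact Finset.prod_eq_zero (Finset.mem_univ i) (by simp [hMatZ, hi])
      rw [this]
      exact Submodule.zero_mem _

variable (μ : Measure (SUN N)) [μ.IsHaarMeasure] [IsProbabilityMeasure μ]

theorem isSpherical_suSchur (hN : 1 ≤ N) {l : Fin N → ℕ} (hl : Antitone l) :
    IsSpherical μ (suSchur l) := by
  induction h : (∑ i, l i) ^ 2 - ∑ i, l i ^ 2 using Nat.strong_induction_on generalizing l with
  | _ n ih =>
    subst h
    obtain ⟨c, hc⟩ := (Submodule.mem_span_image_finset_iff_exists_fun' ℂ).1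
      (prod_hMatZ_sub_schur_mem_span hl)
    have horth : ∀ m k : Fin N → ℕ, Antitone m → Antitone k → ∑ i, m i = ∑ i, k i →
        ∫ V, suSchur m V⁻¹ * suSchur k V ∂μ = if m = k then 1 else 0 := by
      intro m k hm hk hmk
      simp_rw [fun V => mul_comm (suSchur m V⁻¹) (suSchur k V)]
      rw [integral_suSchur_mul_inv μ hN hk hm hmk.symm]
      exact if_congr eq_comm rfl rfl
    refine isSpherical_of_triangular (continuous_suRep (∑ i, l i)) (laterPartitions l) suSchur
      (fun m hm => ?_) (fun m hm k hk => ?_) (continuous_suSchur l) (suSchur_mul_comm l) ?_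
      (fun m hm => ?_) c (rowProj_mul_self _ l) (fun V => polyRep_mul_rowProj _ l _) fun V => ?_
    · rw [mem_laterPartitions] at hm
      have e4 := sum_sq_le_sq_sum m
      refine ih _ ?_ hm.2.1 rfl
      rw [hm.1] at e4 ⊢
      omega
    · rw [mem_laterPartitions] at hm hk
      exact horth m k hm.2.1 hk.2.1 (hm.1.trans hk.1.symm)
    · rw [integral_suSchur_mul_inv μ hN hl hl rfl, if_pos rfl]
    · rw [mem_laterPartitions] at hm
      rw [horth m l hm.2.1 hl hm.1, if_neg]
      rintro rfl
      exact lt_irrefl _ hm.2.2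
    · have h1 := congrFun hc (SUN.toMatrix N V)
      simp only [Finset.sum_apply, Pi.smul_apply, smul_eq_mul, Pi.sub_apply] at h1
      rw [← intRowProj_natCast, suRep_apply, trace_intRowProj_mul_polyRep (by simp)]
      simp only [suSchur]
      rw [h1]
      ring

end Triangularity

section TraceFunctions

variable {N : ℕ} {d : ℕ}

/-- Linear combinations of the matrix coefficients of `polyRep N d`. -/
def IsTraceFun (d : ℕ) (f : Matrix (Fin N) (Fin N) ℂ → ℂ) : Prop :=
  ∃ C : Matrix (ExpMat N d) (ExpMat N d) ℂ, ∀ A, f A = (C * polyRep N d A).trace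

theorem IsTraceFun.const_mul {f : Matrix (Fin N) (Fin N) ℂ → ℂ} (hf : IsTraceFun d f) (c : ℂ) :
    IsTraceFun d fun A => c * f A := by
  obtain ⟨C, hC⟩ := hf
  exact ⟨c • C, fun A => by
    simp only [hC, smul_mul_assoc, Matrix.trace_smul, smul_eq_mul]⟩

theorem isTraceFun_schur_mul {l : Fin N → ℕ} (hl : ∑ i, l i = d) (B : Matrix (Fin N) (Fin N) ℂ) :
    IsTraceFun d fun A => schur l (B * A) :=
  ⟨schurProj d l * polyRep N d B, fun A => by
    rw [mul_assoc, ← map_mul, trace_schurProj_mul_polyRep hl]⟩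

theorem IsTraceFun.eq_of_SUN (hN : 1 ≤ N) {f g : Matrix (Fin N) (Fin N) ℂ → ℂ}
    (hf : IsTraceFun d f) (hg : IsTraceFun d g)
    (h : ∀ V, f (SUN.toMatrix N V) = g (SUN.toMatrix N V)) (A : Matrix (Fin N) (Fin N) ℂ) :
    f A = g A := by
  obtain ⟨C, hC⟩ := hf
  obtain ⟨D, hD⟩ := hg
  have h1 := trace_mul_polyRep_eq_zero hN (C := C - D) (fun V => by
    rw [sub_mul, Matrix.trace_sub, suRep_apply, ← hC, ← hD, h, sub_self]) A
  rw [sub_mul, Matrix.trace_sub, ← hC, ← hD] at h1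
  exact sub_eq_zero.1 h1

open scoped Matrix.Norms.Elementwise in
theorem isTraceFun_integral (μ : Measure (SUN N)) [μ.IsHaarMeasure] {l : Fin N → ℕ}
    (hl : ∑ i, l i = d) {φ : SUN N → ℂ} (hφ : Continuous φ)
    {ψ : SUN N → Matrix (Fin N) (Fin N) ℂ} (hψ : Continuous ψ) :
    IsTraceFun d fun A => ∫ V, φ V * schur l (ψ V * A) ∂μ := by
  refine ⟨∫ V, φ V • (schurProj d l * polyRep N d (ψ V)) ∂μ, fun A => ?_⟩
  have hc : Continuous fun V => φ V • (schurProj d l * polyRep N d (ψ V)) :=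
    hφ.smul (continuous_const.matrix_mul ((continuous_polyRep d).comp hψ))
  have h1 := map_integral_matrix (μ := μ) ((Matrix.traceLinearMap _ ℂ ℂ).comp
    (LinearMap.mulRight ℂ (polyRep N d A))) hc
  simp only [LinearMap.comp_apply, LinearMap.mulRight_apply, Matrix.traceLinearMap_apply] at h1
  rw [h1]
  refine integral_congr_ae (Filter.Eventually.of_forall fun V => ?_)
  simp only
  rw [smul_mul_assoc, Matrix.trace_smul, smul_eq_mul, mul_assoc, ← map_mul,
    trace_schurProj_mul_polyRep hl]

theorem continuous_schur (l : Fin N → ℕ) : Continuous (schur l) := by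
  have : schur l = fun A => (schurProj (∑ i, l i) l * polyRep N (∑ i, l i) A).trace :=
    funext fun A => (trace_schurProj_mul_polyRep rfl A).symm
  rw [this]
  exact (continuous_const.matrix_mul (continuous_polyRep _)).matrix_trace

theorem schur_smul (l : Fin N → ℕ) (c : ℂ) (A : Matrix (Fin N) (Fin N) ℂ) :
    schur l (c • A) = c ^ (∑ i, l i) * schur l A := by
  rw [← trace_schurProj_mul_polyRep rfl, ← trace_schurProj_mul_polyRep rfl, polyRep_smul,
    mul_smul_comm, Matrix.trace_smul, smul_eq_mul]

end TraceFunctions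

section SchurIntegral

variable {N : ℕ} (μ : Measure (SUN N))

/-- The integral of `s_l(V A) s_m(V⁻¹ B)` over the special unitary group. -/
def schurIntegral (l m : Fin N → ℕ) (A B : Matrix (Fin N) (Fin N) ℂ) : ℂ :=
  ∫ V, schur l (SUN.toMatrix N V * A) * schur m (star (SUN.toMatrix N V) * B) ∂μ

theorem schurIntegral_add_const_left (l m : Fin N → ℕ) (q : ℕ) (A B : Matrix (Fin N) (Fin N) ℂ) :
    schurIntegral μ (fun i => l i + q) m A B = A.det ^ q * schurIntegral μ l m A B := by
  simp only [schurIntegral]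
  rw [← integral_const_mul]
  congr 1
  ext V
  rw [schur_add_const, Matrix.det_mul, SUN.det_toMatrix, one_mul, mul_assoc]

theorem schurIntegral_add_const_right (l m : Fin N → ℕ) (q : ℕ) (A B : Matrix (Fin N) (Fin N) ℂ) :
    schurIntegral μ l (fun i => m i + q) A B = B.det ^ q * schurIntegral μ l m A B := by
  simp only [schurIntegral]
  rw [← integral_const_mul]
  congr 1
  ext V
  rw [schur_add_const, Matrix.det_mul, ← SUN.toMatrix_inv, SUN.det_toMatrix, one_mul,
    mul_left_comm]

theorem exists_SUN_eq_smul_one (hN : 1 ≤ N) :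
    ∃ (z : ℂ) (Z : SUN N), IsPrimitiveRoot z N ∧ star z * z = 1 ∧ SUN.toMatrix N Z = z • 1 := by
  have hz := Complex.isPrimitiveRoot_exp N (by omega)
  generalize Complex.exp (2 * Real.pi * Complex.I / N) = z at hz
  have h1 : star z * z = 1 := by
    rw [Complex.star_def, ← Complex.normSq_eq_conj_mul_self, Complex.normSq_eq_norm_sq,
      hz.norm'_eq_one (by omega)]
    simp
  have h2 : z • (1 : Matrix (Fin N) (Fin N) ℂ) ∈ Set.range (SUN.toMatrix N) := by
    rw [SUN.range_toMatrix]
    refine ⟨?_, ?_⟩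
    · rw [star_smul, smul_mul_smul_comm, h1, star_one, one_mul, one_smul]
    · rw [Matrix.det_smul, Fintype.card_fin, hz.pow_eq_one, Matrix.det_one, one_mul]
  obtain ⟨Z, hZ⟩ := h2
  exact ⟨z, Z, hz, h1, hZ⟩

variable [μ.IsHaarMeasure]

theorem schurIntegral_eq_zero (hN : 1 ≤ N) {l m : Fin N → ℕ}
    (h : ¬ (N : ℤ) ∣ ((∑ i, l i : ℕ) : ℤ) - (∑ i, m i : ℕ)) (A B : Matrix (Fin N) (Fin N) ℂ) :
    schurIntegral μ l m A B = 0 := by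
  obtain ⟨z, Z, hz, h1, hZ⟩ := exists_SUN_eq_smul_one hN
  have h2 : schurIntegral μ l m A B =
      z ^ (∑ i, l i) * star z ^ (∑ i, m i) * schurIntegral μ l m A B := by
    conv_lhs => rw [schurIntegral, ← integral_mul_left_eq_self _ Z]
    rw [schurIntegral, ← integral_const_mul]
    congr 1
    ext V
    rw [map_mul, hZ, smul_mul_assoc, one_mul, star_smul, smul_mul_assoc, smul_mul_assoc,
      schur_smul, schur_smul]
    ring
  by_contra h3
  refine h ?_
  have h4 : z ^ (∑ i, l i) * star z ^ (∑ i, m i) = 1 :=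
    mul_right_cancel₀ h3 (by rw [← h2, one_mul])
  have h5 : z ^ (∑ i, l i) = z ^ (∑ i, m i) := by
    rw [← mul_one (z ^ ∑ i, l i), ← one_pow (∑ i, m i), ← h1, mul_pow, ← mul_assoc, h4, one_mul]
  have hz0 : z ≠ 0 := right_ne_zero_of_mul_eq_one h1
  refine (hz.zpow_eq_one_iff_dvd _).1 ?_
  rw [zpow_sub₀ hz0, zpow_natCast, zpow_natCast, h5, div_self (pow_ne_zero _ hz0)]

variable [IsProbabilityMeasure μ]

theorem schurIntegral_of_SUN (hN : 1 ≤ N) {l m : Fin N → ℕ} (hl : Antitone l) (hm : Antitone m)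
    (h : ∑ i, l i = ∑ i, m i) (A B : SUN N) :
    schurIntegral μ l m (SUN.toMatrix N A) (SUN.toMatrix N B) =
      (if l = m then (schur m 1)⁻¹ else 0) * schur m (SUN.toMatrix N A * SUN.toMatrix N B) := by
  have hs := isSpherical_suSchur μ hN hm
  have h0 : schur m (1 : Matrix (Fin N) (Fin N) ℂ) = suSchur m 1 := by rw [suSchur, map_one]
  have h1 : schurIntegral μ l m (SUN.toMatrix N A) (SUN.toMatrix N B) =
      ∫ V, suSchur l V⁻¹ * suSchur m (V * (B * A)) ∂μ := by
    rw [schurIntegral, ← integral_inv_eq_self, ← integral_mul_left_eq_self _ A]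
    congr 1
    ext V
    rw [← SUN.toMatrix_inv, ← map_mul, ← map_mul]
    change suSchur l _ * suSchur m _ = _
    rw [inv_inv, _root_.mul_inv_rev, inv_mul_cancel_right, mul_assoc A, suSchur_mul_comm m A,
      mul_assoc V]
  have h2 := hs.convolution (continuous_suSchur l) (suSchur_mul_comm l) (B * A)
  have h3 : ∫ V, suSchur l V⁻¹ * suSchur m V ∂μ = if l = m then 1 else 0 := by
    simp_rw [fun V => mul_comm (suSchur l V⁻¹) (suSchur m V)]
    rw [integral_suSchur_mul_inv μ hN hm hl h.symm]
    exact if_congr eq_comm rfl rfl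
  have h4 : schur m (SUN.toMatrix N A * SUN.toMatrix N B) = suSchur m (B * A) := by
    rw [suSchur_mul_comm, suSchur, map_mul]
  rw [h3] at h2
  rw [h1, h4, h0]
  refine mul_left_cancel₀ hs.one_ne_zero (h2.trans ?_)
  have := hs.one_ne_zero
  split_ifs
  · field_simp
  · ring

theorem schurIntegral_of_sum_eq (hN : 1 ≤ N) {l m : Fin N → ℕ} (hl : Antitone l) (hm : Antitone m)
    (h : ∑ i, l i = ∑ i, m i) (A B : Matrix (Fin N) (Fin N) ℂ) :
    schurIntegral μ l m A B = (if l = m then (schur m 1)⁻¹ else 0) * schur m (A * B) := by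
  have hstar : Continuous fun V : SUN N => star (SUN.toMatrix N V) :=
    SUN.continuous_toMatrix.star
  refine IsTraceFun.eq_of_SUN (d := ∑ i, m i) hN (g := fun B => _) (isTraceFun_integral μ rfl
    ((continuous_schur l).comp (SUN.continuous_toMatrix.matrix_mul continuous_const)) hstar)
    ((isTraceFun_schur_mul rfl A).const_mul _) (fun W => ?_) B
  change schurIntegral μ l m A (SUN.toMatrix N W) = _
  rw [schur_mul_comm]
  refine IsTraceFun.eq_of_SUN (d := ∑ i, m i) hN
    (f := fun A => schurIntegral μ l m A (SUN.toMatrix N W)) (g := fun A => _) ?_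
    ((isTraceFun_schur_mul rfl (SUN.toMatrix N W)).const_mul _) (fun V => ?_) A
  · simp only [schurIntegral, mul_comm (schur l _)]
    exact isTraceFun_integral μ h ((continuous_schur m).comp (hstar.matrix_mul continuous_const))
      SUN.continuous_toMatrix
  · rw [schur_mul_comm]
    exact schurIntegral_of_SUN μ hN hl hm h V W

theorem schurIntegral_self (hN : 1 ≤ N) {l : Fin N → ℕ} (hl : Antitone l)
    (A B : Matrix (Fin N) (Fin N) ℂ) :
    schurIntegral μ l l A B = schur l (A * B) / schur l (1 : Matrix (Fin N) (Fin N) ℂ) := by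
  rw [schurIntegral_of_sum_eq μ hN hl hl rfl, if_pos rfl, div_eq_inv_mul]

theorem schurIntegral_eq_zero_of_forall_ne (hN : 1 ≤ N) {A B : Matrix (Fin N) (Fin N) ℂ}
    (hA : IsUnit A.det) (hB : IsUnit B.det) {l m : Fin N → ℕ} (hl : Antitone l) (hm : Antitone m)
    (h1 : ∀ q : ℕ, m ≠ fun i => l i + q) (h2 : ∀ q : ℕ, l ≠ fun i => m i + q) :
    schurIntegral μ l m A B = 0 := by
  by_cases h : (N : ℤ) ∣ ((∑ i, l i : ℕ) : ℤ) - (∑ i, m i : ℕ)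
  · obtain ⟨q, hq⟩ := h
    have hsum : ∀ (k : Fin N → ℕ) (q : ℕ), ∑ i, (k i + q) = ∑ i, k i + N * q := by
      simp [Finset.sum_add_distrib]
    obtain ⟨q, rfl | rfl⟩ := q.eq_nat_or_neg
    · have h3 := schurIntegral_of_sum_eq μ hN hl (hm.add_const q) (by
        rw [hsum]
        zify at hq ⊢
        linarith) A B
      rw [if_neg (h2 q), zero_mul, schurIntegral_add_const_right] at h3
      exact (mul_eq_zero.1 h3).resolve_left (pow_ne_zero _ hB.ne_zero)
    · have h3 := schurIntegral_of_sum_eq μ hN (hl.add_const q) hm (by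
        rw [hsum]
        zify at hq ⊢
        linarith) A B
      rw [if_neg (h1 q).symm, zero_mul, schurIntegral_add_const_left] at h3
      exact (mul_eq_zero.1 h3).resolve_left (pow_ne_zero _ hA.ne_zero)
  · exact schurIntegral_eq_zero μ hN h A B

end SchurIntegral

/-- For invertible `A`, `B`:
`∫_{SU(N)} s_λ(UA) s_μ(U†B) dμ(U) = δ_{μ,λ} s_λ(AB)/s_λ(I_N)
+ Σ_{q≥1} δ_{μ,λ+q^N} (det A)^{-q} s_μ(AB)/s_μ(I_N)
+ Σ_{q≥1} δ_{λ,μ+q^N} (det B)^{-q} s_λ(AB)/s_λ(I_N)`,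
and at most one of the three terms on the right-hand side is nonzero. -/
theorem statement11 {N : ℕ} (hN : 1 ≤ N)
    (A B : Matrix (Fin N) (Fin N) ℂ) (hA : IsUnit A.det) (hB : IsUnit B.det)
    (l m : Fin N → ℕ) (hl : Antitone l) (hm : Antitone m)
    (μ : Measure (SUN N)) [μ.IsHaarMeasure] [IsProbabilityMeasure μ] :
    let T1 : ℂ := if m = l then schur l (A * B) / schur l (1 : Matrix (Fin N) (Fin N) ℂ) else 0
    let T2 : ℂ := ∑' q : ℕ+,
      if m = (fun i => l i + (q : ℕ)) then
        A.det ^ (-((q : ℕ) : ℤ)) * (schur m (A * B) / schur m (1 : Matrix (Fin N) (Fin N) ℂ))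
      else 0
    let T3 : ℂ := ∑' q : ℕ+,
      if l = (fun i => m i + (q : ℕ)) then
        B.det ^ (-((q : ℕ) : ℤ)) * (schur l (A * B) / schur l (1 : Matrix (Fin N) (Fin N) ℂ))
      else 0
    (∫ V : SUN N,
        schur l (((V : UN N) : Matrix (Fin N) (Fin N) ℂ) * A) *
          schur m (star ((V : UN N) : Matrix (Fin N) (Fin N) ℂ) * B) ∂μ) = T1 + T2 + T3 ∧
      (T1 = 0 ∨ T2 = 0) ∧ (T1 = 0 ∨ T3 = 0) ∧ (T2 = 0 ∨ T3 = 0) := by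
  intro T1 T2 T3
  change schurIntegral μ l m A B = T1 + T2 + T3 ∧ _
  let i₀ : Fin N := ⟨0, hN⟩
  have z2 : (∀ q : ℕ+, m ≠ fun i => l i + (q : ℕ)) → T2 = 0 := fun h => by
    simp only [T2, if_neg (h _), tsum_zero]
  have z3 : (∀ q : ℕ+, l ≠ fun i => m i + (q : ℕ)) → T3 = 0 := fun h => by
    simp only [T3, if_neg (h _), tsum_zero]
  by_cases h1 : m = l
  · subst h1
    have hne : ∀ q : ℕ+, m ≠ fun i => m i + (q : ℕ) := fun q h => by
      have := congrFun h i₀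
      have := q.pos
      omega
    rw [z2 hne, z3 hne, schurIntegral_self μ hN hm]
    simp [T1]
  · have e1 : T1 = 0 := if_neg h1
    by_cases h2 : ∃ q : ℕ+, m = fun i => l i + (q : ℕ)
    · obtain ⟨q, hq⟩ := h2
      have e3 : T3 = 0 := z3 fun q' h => by
        have := congrFun h i₀
        have := congrFun hq i₀
        have := q.pos
        omega
      have e2 : T2 = A.det ^ (-((q : ℕ) : ℤ)) *
          (schur m (A * B) / schur m (1 : Matrix (Fin N) (Fin N) ℂ)) := by
        simp only [T2]
        rw [tsum_eq_single q, if_pos hq]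
        refine fun q' hq' => if_neg fun h => hq' (PNat.eq ?_)
        have := congrFun h i₀
        have := congrFun hq i₀
        omega
      rw [e1, e3, e2, ← schurIntegral_self μ hN hm]
      refine ⟨?_, by simp⟩
      conv_rhs => rw [show schurIntegral μ m m A B = schurIntegral μ (fun i => l i + (q : ℕ)) m A B
        by rw [← hq]]
      rw [schurIntegral_add_const_left, _root_.zpow_neg, zpow_natCast,
        inv_mul_cancel_left₀ (pow_ne_zero _ hA.ne_zero), zero_add, add_zero]
    · push Not at h2
      have e2 : T2 = 0 := z2 h2
      by_cases h3 : ∃ q : ℕ+, l = fun i => m i + (q : ℕ)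
      · obtain ⟨q, hq⟩ := h3
        have e3 : T3 = B.det ^ (-((q : ℕ) : ℤ)) *
            (schur l (A * B) / schur l (1 : Matrix (Fin N) (Fin N) ℂ)) := by
          simp only [T3]
          rw [tsum_eq_single q, if_pos hq]
          refine fun q' hq' => if_neg fun h => hq' (PNat.eq ?_)
          have := congrFun h i₀
          have := congrFun hq i₀
          omega
        rw [e1, e2, e3, ← schurIntegral_self μ hN hl]
        refine ⟨?_, by simp⟩
        conv_rhs => rw [show schurIntegral μ l l A B =
          schurIntegral μ l (fun i => m i + (q : ℕ)) A B by rw [← hq]]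
        rw [schurIntegral_add_const_right, _root_.zpow_neg, zpow_natCast,
          inv_mul_cancel_left₀ (pow_ne_zero _ hB.ne_zero), zero_add, zero_add]
      · push Not at h3
        have e3 : T3 = 0 := z3 h3
        rw [e1, e2, e3, schurIntegral_eq_zero_of_forall_ne μ hN hA hB hl hm]
        · simp
        · rintro (_ | q)
          · exact h1
          · exact h2 q.succPNat
        · rintro (_ | q)
          · exact Ne.symm h1
          · exact h3 q.succPNat

end
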